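/- Let 2 ≤ r_0 ≤ p−1. Let W be the multihomogeneous component of multidegree (r_0+p−1, p−1, …, p−1) in 𝔽_q[X_0,Y_0,…,X_{f−1},Y_{f−1}] (a G-representation under the twisted action), and let ⟨D_0,…,D_{f−1}⟩ ⊆ W be the 𝔽_q-span of all D_0(P) for P multihomogeneous of multidegree (r_0, 0, …, 0) together with all D_j(P), 1 ≤ j ≤ f−1, for P multihomogeneous of multidegree (r_0−1, 0, …, 0, p, p−1, …, p−1) (with p in position j and p−1 in positions j+1,…,f−1). Then ⟨D_0,…,D_{f−1}⟩ is a G-subrepresentation of W, and there is a G-equivariant 𝔽_{q²}-linear isomorphism ((W/⟨D_0,…,D_{f−1}⟩) ⊗ ⊗_{j=0}^{f−1} V_{p−1}^{Fr^j}) ⊗_{𝔽_q} 𝔽_{q²} ≅ ind_{T(𝔽_q)}^G ω_{2f}^{r_0}. -/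

import Mathlib

open MvPolynomial

noncomputable section

/-! ### The main ring `𝔽_{q²}[X_0,Y_0,…,X_{f−1},Y_{f−1}]`, with `X_j = X (j,0)`,
`Y_j = X (j,1)` -/

/-- The index set `{1,…,f−1}` (for `j = 0`) resp. `{1,…,j−1}` (for `j ≥ 1`) appearing in the
coefficients of the twisted Serre operators. -/
def Dset (f : ℕ) [NeZero f] (j : Fin f) : Finset (Fin f) :=
  if j = 0 then Finset.univ.filter fun l : Fin f => l ≠ 0
  else Finset.univ.filter fun l : Fin f => l ≠ 0 ∧ l < j

/-- `P` is multihomogeneous of multidegree `(r_0,…,r_{f−1})`. -/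
def IsMDegMain {K : Type*} [CommRing K] (f : ℕ) (r : Fin f → ℕ)
    (P : MvPolynomial (Fin f × Fin 2) K) : Prop :=
  ∀ dd ∈ P.support, ∀ l : Fin f, dd (l, 0) + dd (l, 1) = r l

/-- The twisted Serre operator
`D_0 = X_0^p·(X_1⋯X_{f−1})^{p−1}·∂/∂X_0 + Y_0^p·(Y_1⋯Y_{f−1})^{p−1}·∂/∂Y_0` and, for
`1 ≤ j ≤ f−1`, `D_j = X_0^p·(X_1⋯X_{j−1})^{p−1}·∂/∂X_j + Y_0^p·(Y_1⋯Y_{j−1})^{p−1}·∂/∂Y_j`. -/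
def Dmain (p f : ℕ) [NeZero f] (K : Type*) [CommRing K] (j : Fin f) :
    Module.End K (MvPolynomial (Fin f × Fin 2) K) :=
  (LinearMap.mulLeft K
      ((X ((0 : Fin f), (0 : Fin 2)) : MvPolynomial (Fin f × Fin 2) K) ^ p *
        ∏ l ∈ Dset f j, X (l, 0) ^ (p - 1))) ∘ₗ
      (pderiv ((j, 0) : Fin f × Fin 2)).toLinearMap +
    (LinearMap.mulLeft K
      ((X ((0 : Fin f), (1 : Fin 2)) : MvPolynomial (Fin f × Fin 2) K) ^ p *
        ∏ l ∈ Dset f j, X (l, 1) ^ (p - 1))) ∘ₗ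
      (pderiv ((j, 1) : Fin f × Fin 2)).toLinearMap

/-- The multidegree of the source of `D_j`: `(r_0, 0, …, 0)` for `j = 0`, and
`(r_0−1, 0, …, 0, p, p−1, …, p−1)` (with `p` in position `j`) for `j ≥ 1`. -/
def ddegMain (p f : ℕ) [NeZero f] (r0 : ℕ) (j : Fin f) : Fin f → ℕ := fun l =>
  if j = 0 then (if l = 0 then r0 else 0)
  else if l = 0 then r0 - 1 else if l < j then 0 else if l = j then p else p - 1

/-- The subspace `⟨D_0,…,D_{f−1}⟩`: the span of all `D_j(P)` for `P` multihomogeneous of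
the appropriate multidegree. -/
def NMain (p f : ℕ) [NeZero f] (K : Type*) [CommRing K] (r0 : ℕ) :
    Submodule K (MvPolynomial (Fin f × Fin 2) K) :=
  Submodule.span K
    (⋃ j : Fin f, (Dmain p f K j) '' {P | IsMDegMain f (ddegMain p f r0 j) P})

/-- The Frobenius-twisted action of `g ∈ GL₂(𝔽_q)` on the main ring (over `𝔽_{q²}`):
`X_j ↦ a^{p^j}X_j + c^{p^j}Y_j`, `Y_j ↦ b^{p^j}X_j + d^{p^j}Y_j`. -/
def actMain (p f : ℕ) (F K : Type*) [Field F] [CommRing K] [Algebra F K]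
    (g : Matrix (Fin 2) (Fin 2) F) :
    MvPolynomial (Fin f × Fin 2) K →ₗ[K] MvPolynomial (Fin f × Fin 2) K :=
  (aeval fun v : Fin f × Fin 2 =>
    C (algebraMap F K (g 0 v.2) ^ p ^ (v.1 : ℕ)) * X (v.1, 0) +
      C (algebraMap F K (g 1 v.2) ^ p ^ (v.1 : ℕ)) * X (v.1, 1)).toLinearMap

/-! ### The big ring, modeling `(⊗_j V_{r_j+p−1}^{Fr^j}) ⊗ (⊗_j V_{p−1}^{Fr^j})`:
variables `X (s,j,i)` where `s = 0` gives the first tensor factor and `s = 1` the second -/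

/-- Multihomogeneity in the big ring. -/
def IsMDegBig {K : Type*} [CommRing K] (f : ℕ) (r : Fin 2 × Fin f → ℕ)
    (P : MvPolynomial (Fin 2 × Fin f × Fin 2) K) : Prop :=
  ∀ dd ∈ P.support, ∀ (s : Fin 2) (l : Fin f),
    dd (s, l, 0) + dd (s, l, 1) = r (s, l)

/-- The twisted Serre operators on the big ring (acting on the first tensor factor). -/
def Dbig (p f : ℕ) [NeZero f] (K : Type*) [CommRing K] (j : Fin f) :
    Module.End K (MvPolynomial (Fin 2 × Fin f × Fin 2) K) :=
  (LinearMap.mulLeft K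
      ((X ((0 : Fin 2), (0 : Fin f), (0 : Fin 2)) :
          MvPolynomial (Fin 2 × Fin f × Fin 2) K) ^ p *
        ∏ l ∈ Dset f j, X (0, l, 0) ^ (p - 1))) ∘ₗ
      (pderiv ((0, j, 0) : Fin 2 × Fin f × Fin 2)).toLinearMap +
    (LinearMap.mulLeft K
      ((X ((0 : Fin 2), (0 : Fin f), (1 : Fin 2)) :
          MvPolynomial (Fin 2 × Fin f × Fin 2) K) ^ p *
        ∏ l ∈ Dset f j, X (0, l, 1) ^ (p - 1))) ∘ₗ
      (pderiv ((0, j, 1) : Fin 2 × Fin f × Fin 2)).toLinearMap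

/-- `⟨D_0,…,D_{f−1}⟩ ⊗ (⊗_j V_{p−1}^{Fr^j})` inside the big ring. -/
def NBig (p f : ℕ) [NeZero f] (K : Type*) [CommRing K] (r0 : ℕ) :
    Submodule K (MvPolynomial (Fin 2 × Fin f × Fin 2) K) :=
  Submodule.span K
    (⋃ j : Fin f, (Dbig p f K j) ''
      {P | IsMDegBig f
        (fun sl => if sl.1 = 0 then ddegMain p f r0 j sl.2 else p - 1) P})

/-- The Frobenius-twisted action of `g ∈ GL₂(𝔽_q)` on the big ring. -/
def actBig (p f : ℕ) (F K : Type*) [Field F] [CommRing K] [Algebra F K]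
    (g : Matrix (Fin 2) (Fin 2) F) :
    MvPolynomial (Fin 2 × Fin f × Fin 2) K →ₗ[K]
      MvPolynomial (Fin 2 × Fin f × Fin 2) K :=
  (aeval fun w : Fin 2 × Fin f × Fin 2 =>
    C (algebraMap F K (g 0 w.2.2) ^ p ^ (w.2.1 : ℕ)) * X (w.1, w.2.1, 0) +
      C (algebraMap F K (g 1 w.2.2) ^ p ^ (w.2.1 : ℕ)) * X (w.1, w.2.1, 1)).toLinearMap

end

/-! ### Multihomogeneity as weighted homogeneity -/

/-- The weight giving `X (s, l, i)` the multidegree `e_{(s, l)}`. -/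
def bigWeight (f : ℕ) (w : Fin 2 × Fin f × Fin 2) : Fin 2 × Fin f → ℕ :=
  Pi.single (w.1, w.2.1) 1

/-- The weight giving `X (l, i)` the multidegree `e_l`. -/
def mainWeight (f : ℕ) (w : Fin f × Fin 2) : Fin f → ℕ :=
  Pi.single w.1 1

theorem weight_bigWeight (f : ℕ) (d : Fin 2 × Fin f × Fin 2 →₀ ℕ) (s : Fin 2) (l : Fin f) :
    Finsupp.weight (bigWeight f) d (s, l) = d (s, l, 0) + d (s, l, 1) := by
  rw [Finsupp.weight_apply, Finsupp.sum_fintype _ _ (by simp), Finset.sum_apply,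
    Fintype.sum_prod_type, Finset.sum_eq_single s, Fintype.sum_prod_type,
    Finset.sum_eq_single l]
  · simp [bigWeight]
  · intro b _ hb
    simp [bigWeight, hb.symm]
  · simp
  · intro b _ hb
    simp [bigWeight, hb.symm]
  · simp

theorem weight_mainWeight (f : ℕ) (d : Fin f × Fin 2 →₀ ℕ) (l : Fin f) :
    Finsupp.weight (mainWeight f) d l = d (l, 0) + d (l, 1) := by
  rw [Finsupp.weight_apply, Finsupp.sum_fintype _ _ (by simp), Finset.sum_apply,
    Fintype.sum_prod_type, Finset.sum_eq_single l]
  · simp [mainWeight]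
  · intro b _ hb
    simp [mainWeight, hb.symm]
  · simp

theorem isMDegBig_iff {K : Type*} [CommRing K] {f : ℕ} {r : Fin 2 × Fin f → ℕ}
    {P : MvPolynomial (Fin 2 × Fin f × Fin 2) K} :
    IsMDegBig f r P ↔ IsWeightedHomogeneous (bigWeight f) P r := by
  unfold IsMDegBig IsWeightedHomogeneous
  refine forall_congr' fun d => ?_
  rw [mem_support_iff, funext_iff, Prod.forall]
  simp only [weight_bigWeight]

theorem isMDegMain_iff {K : Type*} [CommRing K] {f : ℕ} {r : Fin f → ℕ}
    {P : MvPolynomial (Fin f × Fin 2) K} :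
    IsMDegMain f r P ↔ IsWeightedHomogeneous (mainWeight f) P r := by
  unfold IsMDegMain IsWeightedHomogeneous
  refine forall_congr' fun d => ?_
  rw [mem_support_iff, funext_iff]
  simp only [weight_mainWeight]

theorem MvPolynomial.IsWeightedHomogeneous.aeval_of_forall {σ τ R M N : Type*} [CommSemiring R]
    [AddCommMonoid M] [AddCommMonoid N] {w : σ → M} {w' : τ → N} {n : M}
    {φ : MvPolynomial σ R} (hφ : IsWeightedHomogeneous w φ n) (L : M →+ N)
    (g : σ → MvPolynomial τ R) (hg : ∀ i, IsWeightedHomogeneous w' (g i) (L (w i))) :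
    IsWeightedHomogeneous w' (aeval g φ) (L n) := by
  rw [φ.as_sum, map_sum]
  refine IsWeightedHomogeneous.sum _ _ _ fun d hd => ?_
  rw [aeval_monomial, algebraMap_eq]
  refine IsWeightedHomogeneous.C_mul ?_ _
  rw [← hφ (mem_support_iff.mp hd), Finsupp.weight_apply, Finsupp.sum, map_sum, Finsupp.prod]
  refine IsWeightedHomogeneous.prod _ _ _ fun i _ => ?_
  rw [map_nsmul]
  exact (hg i).pow _

/-- Rescaling the variables of multidegree `e_{(s, l)}` by `c (s, l)`. -/
theorem IsMDegBig.aeval_mul {K A : Type*} [CommRing K] [CommRing A] [Algebra K A] {f : ℕ}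
    {r : Fin 2 × Fin f → ℕ} {P : MvPolynomial (Fin 2 × Fin f × Fin 2) K}
    (hP : IsMDegBig f r P) (c : Fin 2 × Fin f → A) (g : Fin 2 × Fin f × Fin 2 → A) :
    aeval (fun w => c (w.1, w.2.1) * g w) P = (∏ sl, c sl ^ r sl) * aeval g P := by
  conv_lhs => rw [P.as_sum]
  conv_rhs => rw [P.as_sum]
  rw [map_sum, map_sum, Finset.mul_sum]
  refine Finset.sum_congr rfl fun d hd => ?_
  simp only [aeval_monomial, mul_pow, Finsupp.prod_mul]
  have : (d.prod fun a b => c (a.1, a.2.1) ^ b) = ∏ sl, c sl ^ r sl := by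
    rw [Finsupp.prod_fintype _ _ (by simp), Fintype.prod_prod_type, Fintype.prod_prod_type]
    refine Finset.prod_congr rfl fun s _ => ?_
    rw [Fintype.prod_prod_type]
    refine Finset.prod_congr rfl fun l _ => ?_
    rw [Fin.prod_univ_two, ← pow_add, hP d hd s l]
  rw [this]
  ring

theorem isMDegBig_actBig {p f : ℕ} {F K : Type*} [Field F] [CommRing K] [Algebra F K]
    {r : Fin 2 × Fin f → ℕ} {P : MvPolynomial (Fin 2 × Fin f × Fin 2) K}
    (hP : IsMDegBig f r P) (g : Matrix (Fin 2) (Fin 2) F) :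
    IsMDegBig f r (actBig p f F K g P) := by
  rw [isMDegBig_iff] at hP ⊢
  refine hP.aeval_of_forall (AddMonoidHom.id _) _ fun w => ?_
  exact ((isWeightedHomogeneous_X K (bigWeight f) (w.1, w.2.1, 0)).C_mul _).add
    ((isWeightedHomogeneous_X K (bigWeight f) (w.1, w.2.1, 1)).C_mul _)

/-! ### The functional inducing the isomorphism -/

/-- The row vector `(1, α) g`. -/
def rowVec {F K : Type*} [Field F] [Field K] [Algebra F K] (α : K)
    (g : Matrix (Fin 2) (Fin 2) F) (i : Fin 2) : K :=
  algebraMap F K (g 0 i) + algebraMap F K (g 1 i) * α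

/-- The point with coordinates `v^{p^j}` in the first factor and `(v^q)^{p^j}` in the second. -/
def evPt (p f : ℕ) {K : Type*} [Field K] (v : Fin 2 → K) (w : Fin 2 × Fin f × Fin 2) : K :=
  if w.1 = 0 then v w.2.2 ^ p ^ (w.2.1 : ℕ) else (v w.2.2 ^ p ^ f) ^ p ^ (w.2.1 : ℕ)

/-- The line with coordinates `v T + v^q` in position `0` of the first factor, and the constant
coordinates `(v^q)^{p^j}` elsewhere. -/
noncomputable def linePt (p f : ℕ) [NeZero f] {K : Type*} [Field K] (v : Fin 2 → K)
    (w : Fin 2 × Fin f × Fin 2) : Polynomial K :=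
  if w.1 = 0 ∧ w.2.1 = 0 then
    Polynomial.C (v w.2.2) * Polynomial.X + Polynomial.C (v w.2.2 ^ p ^ f)
  else Polynomial.C ((v w.2.2 ^ p ^ f) ^ p ^ (w.2.1 : ℕ))

/-- `r_0 - 1` times the evaluation at `evPt`, minus the coefficient of `T^{r_0 - 2}` in the
restriction to `linePt`. -/
noncomputable def cuspFunctional (p f : ℕ) [NeZero f] (r0 : ℕ) {K : Type*} [Field K]
    (v : Fin 2 → K) : MvPolynomial (Fin 2 × Fin f × Fin 2) K →ₗ[K] K :=
  ((r0 : K) - 1) • (aeval (evPt p f v)).toLinearMap -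
    (Polynomial.lcoeff K (r0 - 2)) ∘ₗ (aeval (linePt p f v)).toLinearMap

theorem cuspFunctional_apply (p f : ℕ) [NeZero f] (r0 : ℕ) {K : Type*} [Field K] (v : Fin 2 → K)
    (P : MvPolynomial (Fin 2 × Fin f × Fin 2) K) :
    cuspFunctional p f r0 v P =
      ((r0 : K) - 1) * aeval (evPt p f v) P - (aeval (linePt p f v) P).coeff (r0 - 2) := rfl

theorem cuspFunctional_actBig (p f : ℕ) [NeZero f] [Fact p.Prime] (r0 : ℕ) {F K : Type*} [Field F]
    [Field K] [Algebra F K] [CharP K p]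
    (hF : ∀ a : F, algebraMap F K a ^ p ^ f = algebraMap F K a) (v : Fin 2 → K)
    (g : Matrix (Fin 2) (Fin 2) F) (P : MvPolynomial (Fin 2 × Fin f × Fin 2) K) :
    cuspFunctional p f r0 v (actBig p f F K g P) =
      cuspFunctional p f r0
        (fun i => algebraMap F K (g 0 i) * v 0 + algebraMap F K (g 1 i) * v 1) P := by
  have h1 : (aeval (evPt p f v) (actBig p f F K g P) : K) =
      aeval (evPt p f fun i => algebraMap F K (g 0 i) * v 0 + algebraMap F K (g 1 i) * v 1) P := by
    rw [actBig, AlgHom.toLinearMap_apply, ← AlgHom.comp_apply, comp_aeval]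
    congr 2
    funext ⟨s, l, i⟩
    by_cases hs : s = 0
    · simp [evPt, hs, add_pow_char_pow, mul_pow]
    · simp [evPt, hs, add_pow_char_pow, mul_pow, hF]
  have h2 : (aeval (linePt p f v) (actBig p f F K g P) : Polynomial K) =
      aeval (linePt p f fun i => algebraMap F K (g 0 i) * v 0 + algebraMap F K (g 1 i) * v 1)
        P := by
    rw [actBig, AlgHom.toLinearMap_apply, ← AlgHom.comp_apply, comp_aeval]
    congr 2
    funext ⟨s, l, i⟩
    by_cases hs : s = 0 ∧ l = 0
    · obtain ⟨rfl, rfl⟩ := hs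
      simp [linePt, add_pow_char_pow, mul_pow, hF]
      ring
    · simp [linePt, hs, add_pow_char_pow, mul_pow, hF]
  rw [cuspFunctional_apply, cuspFunctional_apply, h1, h2]

theorem rowVec_mul {F K : Type*} [Field F] [Field K] [Algebra F K] (α : K)
    (x g : Matrix (Fin 2) (Fin 2) F) :
    rowVec α (x * g) = fun i =>
      algebraMap F K (g 0 i) * rowVec α x 0 + algebraMap F K (g 1 i) * rowVec α x 1 := by
  funext i
  simp only [rowVec, Matrix.mul_apply, Fin.sum_univ_two, map_add, map_mul]
  ring

theorem rowVec_torus_mul {F K : Type*} [Field F] [Field K] [Algebra F K] {α : K} {β : F}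
    (hα : α ^ 2 = algebraMap F K β) (u v : F) (g : Matrix (Fin 2) (Fin 2) F) :
    rowVec α (!![u, v * β; v, u] * g) = fun i =>
      (algebraMap F K u + algebraMap F K v * α) * rowVec α g i := by
  funext i
  simp [rowVec, Matrix.mul_apply, Fin.sum_univ_two, ← hα]
  ring

/-- The multidegree of `W ⊗ ⊗_j V_{p-1}^{Fr^j}`. -/
def bigDeg (p f : ℕ) [NeZero f] (r0 : ℕ) (sl : Fin 2 × Fin f) : ℕ :=
  if sl.1 = 0 ∧ sl.2 = 0 then r0 + p - 1 else p - 1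

theorem sum_pow_mul_pred (p f : ℕ) (hp : 1 ≤ p) :
    ∑ l : Fin f, p ^ (l : ℕ) * (p - 1) + 1 = p ^ f := by
  rw [← Finset.sum_mul, Fin.sum_univ_eq_sum_range (fun i => p ^ i), geom_sum_mul_of_one_le hp]
  exact Nat.sub_add_cancel (Nat.one_le_pow _ _ hp)

theorem prod_pow_pow_pred {M : Type*} [CommMonoid M] (p f : ℕ) (hp : 1 ≤ p) (y : M) :
    (∏ l : Fin f, (y ^ p ^ (l : ℕ)) ^ (p - 1)) * y = y ^ p ^ f := by
  rw [← sum_pow_mul_pred p f hp, pow_succ, ← Finset.prod_pow_eq_pow_sum]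
  simp only [pow_mul]

theorem prod_pow_pow_bigDeg_zero {M : Type*} [CommMonoid M] (p f : ℕ) [NeZero f] (hp : 1 ≤ p)
    (r0 : ℕ) (y : M) :
    (∏ l : Fin f, (y ^ p ^ (l : ℕ)) ^ bigDeg p f r0 (0, l)) * y = y ^ r0 * y ^ p ^ f := by
  have h : ∀ l : Fin f, (y ^ p ^ (l : ℕ)) ^ bigDeg p f r0 (0, l) =
      (if l = 0 then y ^ r0 else 1) * (y ^ p ^ (l : ℕ)) ^ (p - 1) := by
    intro l
    by_cases hl : l = 0
    · subst hl
      simp only [bigDeg, and_self, if_true, Fin.val_zero, pow_zero, pow_one]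
      rw [← pow_add]
      congr 1
      omega
    · simp [bigDeg, hl]
  simp only [h, Finset.prod_mul_distrib, Finset.prod_ite_eq', Finset.mem_univ, if_true]
  rw [mul_assoc, prod_pow_pow_pred p f hp]

theorem cuspFunctional_smul (p f : ℕ) [NeZero f] [Fact p.Prime] {r0 : ℕ} (hr0 : 2 ≤ r0)
    {K : Type*} [Field K] (hK : ∀ a : K, (a ^ p ^ f) ^ p ^ f = a) (v : Fin 2 → K) {c : K}
    (hc : c ≠ 0) {P : MvPolynomial (Fin 2 × Fin f × Fin 2) K} (hP : IsMDegBig f (bigDeg p f r0) P) :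
    cuspFunctional p f r0 (fun i => c * v i) P = c ^ r0 * cuspFunctional p f r0 v P := by
  have hp : 1 ≤ p := (Fact.out : p.Prime).one_le
  have h1 : aeval (evPt p f fun i => c * v i) P = c ^ r0 * aeval (evPt p f v) P := by
    have h := hP.aeval_mul
      (fun sl => if sl.1 = 0 then c ^ p ^ (sl.2 : ℕ) else (c ^ p ^ f) ^ p ^ (sl.2 : ℕ)) (evPt p f v)
    convert h using 2
    · congr 1
      funext ⟨s, l, i⟩
      by_cases hs : s = 0 <;> simp [evPt, hs, mul_pow]
    · rw [Fintype.prod_prod_type, Fin.prod_univ_two]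
      simp only [if_true, one_ne_zero, if_false]
      have e1 := prod_pow_pow_bigDeg_zero p f hp r0 c
      have e2 := prod_pow_pow_pred p f hp (c ^ p ^ f)
      rw [hK] at e2
      refine mul_right_cancel₀ (mul_ne_zero hc (pow_ne_zero (p ^ f) hc)) ?_
      rw [mul_mul_mul_comm, e1]
      simp only [bigDeg, one_ne_zero, false_and, if_false]
      rw [e2]
      ring
  have h2 : (aeval (linePt p f fun i => c * v i) P).coeff (r0 - 2) =
      c ^ r0 * (aeval (linePt p f v) P).coeff (r0 - 2) := by
    have h := hP.aeval_mul
      (fun sl => Polynomial.C ((c ^ p ^ f) ^ p ^ (sl.2 : ℕ)))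
      (fun w => (linePt p f v w).comp (Polynomial.C (c / c ^ p ^ f) * Polynomial.X))
    have e0 : (fun w : Fin 2 × Fin f × Fin 2 => Polynomial.C ((c ^ p ^ f) ^ p ^ (w.2.1 : ℕ)) *
        (linePt p f v w).comp (Polynomial.C (c / c ^ p ^ f) * Polynomial.X)) =
        linePt p f fun i => c * v i := by
      funext ⟨s, l, i⟩
      by_cases hs : s = 0 ∧ l = 0
      · obtain ⟨rfl, rfl⟩ := hs
        simp only [linePt, and_self, if_true, Fin.val_zero, pow_zero, pow_one, Polynomial.add_comp,
          Polynomial.mul_comp, Polynomial.C_comp, Polynomial.X_comp, mul_pow, mul_add,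
          ← Polynomial.C_mul]
        have hy : c = c ^ p ^ f * (c / c ^ p ^ f) := (mul_div_cancel₀ _ (pow_ne_zero _ hc)).symm
        rw [show c * v i = c ^ p ^ f * (c / c ^ p ^ f) * v i by rw [← hy]]
        simp only [Polynomial.C_mul]
        ring
      · simp [linePt, hs, mul_pow]
    have e3 : aeval (fun w => (linePt p f v w).comp
        (Polynomial.C (c / c ^ p ^ f) * Polynomial.X)) P =
        (aeval (linePt p f v) P).comp (Polynomial.C (c / c ^ p ^ f) * Polynomial.X) := by
      have := comp_aeval (R := K) (linePt p f v)
        (Polynomial.aeval (Polynomial.C (c / c ^ p ^ f) * Polynomial.X))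
      exact (DFunLike.congr_fun this P).symm
    rw [e0, e3] at h
    rw [h]
    simp only [← Polynomial.C_pow, ← map_prod, Polynomial.coeff_C_mul,
      Polynomial.comp_C_mul_X_coeff]
    rw [mul_left_comm, mul_comm (c ^ r0)]
    congr 1
    rw [Fintype.prod_prod_type, Fin.prod_univ_two]
    have e1 := prod_pow_pow_bigDeg_zero p f hp r0 (c ^ p ^ f)
    have e2 := prod_pow_pow_pred p f hp (c ^ p ^ f)
    rw [hK] at e1 e2
    simp only [bigDeg, one_ne_zero, false_and, if_false] at e1 e2 ⊢
    have hy : c ^ p ^ f ≠ 0 := pow_ne_zero _ hc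
    refine mul_right_cancel₀ (mul_ne_zero hy hy) ?_
    rw [mul_right_comm, mul_mul_mul_comm, e1, e2, div_pow]
    obtain ⟨m, rfl⟩ := Nat.exists_eq_add_of_le hr0
    rw [Nat.add_sub_cancel_left]
    field_simp
    ring
  rw [cuspFunctional_apply, cuspFunctional_apply, h1, h2]
  ring

/-! ### The functional kills the images of the Serre operators -/

theorem IsMDegBig.euler {K : Type*} [CommRing K] {f : ℕ} {r : Fin 2 × Fin f → ℕ}
    {P : MvPolynomial (Fin 2 × Fin f × Fin 2) K} (hP : IsMDegBig f r P) (s : Fin 2) (l : Fin f) :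
    X (s, l, 0) * pderiv (s, l, 0) P + X (s, l, 1) * pderiv (s, l, 1) P = r (s, l) • P := by
  have h : IsWeightedHomogeneous
      (fun w : Fin 2 × Fin f × Fin 2 => if w.1 = s ∧ w.2.1 = l then 1 else 0) P (r (s, l)) := by
    intro d hd
    rw [← hP d (mem_support_iff.mpr hd) s l, ← weight_bigWeight, Finsupp.weight_apply,
      Finsupp.weight_apply, Finsupp.sum_fintype _ _ (by simp), Finsupp.sum_fintype _ _ (by simp),
      Finset.sum_apply]
    refine Finset.sum_congr rfl fun w _ => ?_
    simp [bigWeight, Pi.single_apply, Prod.ext_iff, eq_comm]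
  rw [← h.sum_weight_X_mul_pderiv, Fintype.sum_prod_type, Finset.sum_eq_single s,
    Fintype.sum_prod_type, Finset.sum_eq_single l]
  · simp
  · intro b _ hb
    simp [hb]
  · simp
  · intro b _ hb
    simp [hb]
  · simp

theorem sum_Dset (p f : ℕ) [NeZero f] (hp : 1 ≤ p) (j : Fin f) :
    p + ∑ l ∈ Dset f j, p ^ (l : ℕ) * (p - 1) = p ^ (if j = 0 then f else (j : ℕ)) := by
  have key : ∀ n, 1 ≤ n → p + ∑ i ∈ Finset.Ico 1 n, p ^ i * (p - 1) = p ^ n := by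
    intro n hn
    induction n, hn using Nat.le_induction with
    | base => simp
    | succ n hn ih =>
      obtain ⟨k, rfl⟩ := Nat.exists_eq_add_of_le hp
      rw [Finset.sum_Ico_succ_top hn, ← add_assoc, ih, Nat.add_sub_cancel_left]
      ring
  have hf : 1 ≤ f := NeZero.one_le
  have hmem : ∀ l : Fin f, l ∈ Dset f j ↔
      (l : ℕ) ∈ Finset.Ico 1 (if j = 0 then f else (j : ℕ)) := by
    intro l
    have := l.2
    unfold Dset
    split_ifs <;>
      simp only [Finset.mem_filter, Finset.mem_univ, true_and, Finset.mem_Ico, ne_eq, Fin.ext_iff,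
        Fin.val_zero, Fin.lt_def] <;> omega
  rw [← key (if j = 0 then f else (j : ℕ))]
  · congr 1
    refine Finset.sum_bij (fun l _ => (l : ℕ)) (fun l hl => (hmem l).1 hl)
      (fun _ _ _ _ h => Fin.ext h) (fun b hb => ?_) (fun _ _ => rfl)
    have hbf : b < f := by
      have hj := j.2
      rw [Finset.mem_Ico] at hb
      split_ifs at hb <;> omega
    exact ⟨⟨b, hbf⟩, (hmem _).2 hb, rfl⟩
  · split_ifs with h
    · exact hf
    · rw [Fin.ext_iff, Fin.val_zero] at h
      omega

theorem pow_mul_prod_Dset {M : Type*} [CommMonoid M] (p f : ℕ) [NeZero f] (hp : 1 ≤ p) (j : Fin f)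
    (y : M) : y ^ p * ∏ l ∈ Dset f j, (y ^ p ^ (l : ℕ)) ^ (p - 1) =
      y ^ p ^ (if j = 0 then f else (j : ℕ)) := by
  rw [← sum_Dset p f hp, pow_add, ← Finset.prod_pow_eq_pow_sum]
  simp only [pow_mul]

theorem ne_zero_of_mem_Dset {f : ℕ} [NeZero f] {j l : Fin f} (h : l ∈ Dset f j) : l ≠ 0 := by
  unfold Dset at h
  split_ifs at h <;> simp_all

theorem Dbig_apply (p f : ℕ) [NeZero f] (K : Type*) [CommRing K] (j : Fin f)
    (P : MvPolynomial (Fin 2 × Fin f × Fin 2) K) :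
    Dbig p f K j P =
      (X (0, 0, 0) ^ p * ∏ l ∈ Dset f j, X (0, l, 0) ^ (p - 1)) * pderiv (0, j, 0) P +
      (X (0, 0, 1) ^ p * ∏ l ∈ Dset f j, X (0, l, 1) ^ (p - 1)) * pderiv (0, j, 1) P := rfl

theorem derivative_aeval_mvPolynomial {σ R : Type*} [Fintype σ] [CommRing R]
    (g : σ → Polynomial R) (P : MvPolynomial σ R) :
    Polynomial.derivative (aeval g P) =
      ∑ w, aeval g (pderiv w P) * Polynomial.derivative (g w) := by
  classical
  induction P using MvPolynomial.induction_on with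
  | C a => simp
  | add P Q hP hQ => simp [hP, hQ, add_mul, Finset.sum_add_distrib]
  | mul_X P i hP =>
    have h : ∀ w, aeval g (pderiv w (P * X i)) * Polynomial.derivative (g w) =
        aeval g (pderiv w P) * Polynomial.derivative (g w) * g i +
          if i = w then aeval g P * Polynomial.derivative (g w) else 0 := by
      intro w
      rw [pderiv_mul, map_add, map_mul, map_mul, aeval_X]
      by_cases hw : i = w
      · subst hw
        rw [pderiv_X_self, map_one, if_pos rfl]
        ring
      · rw [pderiv_X_of_ne hw, map_zero, if_neg hw]
        ring
    rw [map_mul, aeval_X, Polynomial.derivative_mul, hP, Finset.sum_congr rfl fun w _ => h w,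
      Finset.sum_add_distrib, Finset.sum_mul, Finset.sum_ite_eq, if_pos (Finset.mem_univ i)]

theorem Polynomial.coeff_prod_sum_of_natDegree_le {ι R : Type*} [CommSemiring R] (s : Finset ι)
    (g : ι → Polynomial R) (e : ι → ℕ) (h : ∀ i ∈ s, (g i).natDegree ≤ e i) :
    (∏ i ∈ s, g i).natDegree ≤ ∑ i ∈ s, e i ∧
      (∏ i ∈ s, g i).coeff (∑ i ∈ s, e i) = ∏ i ∈ s, (g i).coeff (e i) := by
  classical
  induction s using Finset.induction_on with
  | empty => simp
  | insert a s ha ih =>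
    obtain ⟨h1, h2⟩ := ih fun i hi => h i (Finset.mem_insert_of_mem hi)
    have h3 := h a (Finset.mem_insert_self a s)
    rw [Finset.prod_insert ha, Finset.sum_insert ha, Finset.prod_insert ha, ← h2]
    exact ⟨Polynomial.natDegree_mul_le_of_le h3 h1,
      Polynomial.coeff_mul_add_eq_of_natDegree_le h3 h1⟩

/-- The leading coefficient along `linePt` is the value at `evPt`. -/
theorem IsMDegBig.coeff_aeval_linePt {p f : ℕ} [NeZero f] {K : Type*} [Field K] (v : Fin 2 → K)
    {r : Fin 2 × Fin f → ℕ} {P : MvPolynomial (Fin 2 × Fin f × Fin 2) K} (hP : IsMDegBig f r P)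
    (hr : ∀ l, l ≠ 0 → r (0, l) = 0) :
    (aeval (linePt p f v) P).coeff (r (0, 0)) = aeval (evPt p f v) P := by
  conv_lhs => rw [P.as_sum]
  conv_rhs => rw [P.as_sum]
  rw [map_sum, map_sum, Polynomial.finsetSum_coeff]
  refine Finset.sum_congr rfl fun d hd => ?_
  rw [aeval_monomial, aeval_monomial, Finsupp.prod_fintype _ _ (by simp),
    Finsupp.prod_fintype _ _ (by simp), ← Polynomial.C_eq_algebraMap, Polynomial.coeff_C_mul]
  have hd0 : ∀ l i, l ≠ 0 → d (0, l, i) = 0 := by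
    intro l i hl
    have := hP d hd 0 l
    rw [hr l hl] at this
    fin_cases i <;> simp <;> omega
  have key := Polynomial.coeff_prod_sum_of_natDegree_le Finset.univ
    (fun w => linePt p f v w ^ d w) (fun w => if w.1 = 0 ∧ w.2.1 = 0 then d w else 0) (by
      intro w _
      unfold linePt
      split_ifs
      · exact (Polynomial.natDegree_pow_le_of_le _ Polynomial.natDegree_linear_le).trans
          (by simp)
      · rw [← Polynomial.C_pow, Polynomial.natDegree_C])
  have hsum : (∑ w : Fin 2 × Fin f × Fin 2, if w.1 = 0 ∧ w.2.1 = 0 then d w else 0) =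
      r (0, 0) := by
    rw [Fintype.sum_prod_type, Fin.sum_univ_two, Fintype.sum_prod_type, Finset.sum_eq_single 0,
      ← hP d hd 0 0]
    · simp
    · intro b _ hb
      simp [hb]
    · simp
  rw [hsum] at key
  rw [key.2]
  congr 1
  refine Finset.prod_congr rfl fun w _ => ?_
  obtain ⟨s, l, i⟩ := w
  by_cases hs : s = 0
  · subst hs
    by_cases hl : l = 0
    · subst hl
      simp only [linePt, evPt, and_self, if_true, Fin.val_zero, pow_zero, pow_one]
      have := Polynomial.coeff_pow_of_natDegree_le (m := d (0, 0, i)) (n := 1)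
        (p := Polynomial.C (v i) * Polynomial.X + Polynomial.C (v i ^ p ^ f))
        Polynomial.natDegree_linear_le
      rw [mul_one] at this
      rw [this]
      simp only [Polynomial.coeff_add, Polynomial.coeff_C_mul, Polynomial.coeff_X_one, mul_one,
        Polynomial.coeff_C_succ, add_zero]
    · simp [hd0 l i hl, hl]
  · simp only [linePt, evPt, hs, false_and, if_false, ← Polynomial.C_pow, Polynomial.coeff_C_zero]

theorem aeval_evPt_Dset (p f : ℕ) [NeZero f] (hp : 1 ≤ p) {K : Type*} [Field K] (v : Fin 2 → K)
    (j : Fin f) (i : Fin 2) :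
    aeval (evPt p f v) (X (0, 0, i) ^ p * ∏ l ∈ Dset f j, X (0, l, i) ^ (p - 1) :
      MvPolynomial (Fin 2 × Fin f × Fin 2) K) = v i ^ p ^ (if j = 0 then f else (j : ℕ)) := by
  rw [← pow_mul_prod_Dset p f hp]
  simp [evPt]

theorem aeval_linePt_Dset (p f : ℕ) [NeZero f] [Fact p.Prime] {K : Type*} [Field K] [CharP K p]
    (v : Fin 2 → K) (j : Fin f) (i : Fin 2) :
    ∃ Z : Polynomial K,
      aeval (linePt p f v) (X (0, 0, i) ^ p * ∏ l ∈ Dset f j, X (0, l, i) ^ (p - 1) :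
        MvPolynomial (Fin 2 × Fin f × Fin 2) K) =
      Polynomial.X ^ p * Z +
        Polynomial.C ((v i ^ p ^ f) ^ p ^ (if j = 0 then f else (j : ℕ))) := by
  have hp : 1 ≤ p := (Fact.out : p.Prime).one_le
  refine ⟨Polynomial.C (v i) ^ p *
    ∏ l ∈ Dset f j, Polynomial.C ((v i ^ p ^ f) ^ p ^ (l : ℕ)) ^ (p - 1), ?_⟩
  have h : ∏ l ∈ Dset f j, linePt p f v (0, l, i) ^ (p - 1) =
      ∏ l ∈ Dset f j, Polynomial.C ((v i ^ p ^ f) ^ p ^ (l : ℕ)) ^ (p - 1) :=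
    Finset.prod_congr rfl fun l hl => by simp [linePt, ne_zero_of_mem_Dset hl]
  have h0 : linePt p f v (0, 0, i) =
      Polynomial.C (v i) * Polynomial.X + Polynomial.C (v i ^ p ^ f) := by simp [linePt]
  rw [map_mul, map_pow, map_prod, aeval_X, h0]
  simp only [map_pow, aeval_X] at h ⊢
  rw [h, add_pow_char, add_mul, mul_pow, ← pow_mul_prod_Dset p f hp j]
  ring

/-- Each coefficient below `p` of the image of `D_j P` along `linePt`. -/
theorem coeff_aeval_linePt_Dbig (p f : ℕ) [NeZero f] [Fact p.Prime] {K : Type*} [Field K]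
    [CharP K p] (v : Fin 2 → K) (j : Fin f) (P : MvPolynomial (Fin 2 × Fin f × Fin 2) K)
    {m : ℕ} (hm : m < p) :
    (aeval (linePt p f v) (Dbig p f K j P)).coeff m =
      (v 0 ^ p ^ f) ^ p ^ (if j = 0 then f else (j : ℕ)) *
        (aeval (linePt p f v) (pderiv (0, j, 0) P)).coeff m +
      (v 1 ^ p ^ f) ^ p ^ (if j = 0 then f else (j : ℕ)) *
        (aeval (linePt p f v) (pderiv (0, j, 1) P)).coeff m := by
  obtain ⟨Z0, h0⟩ := aeval_linePt_Dset p f v j 0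
  obtain ⟨Z1, h1⟩ := aeval_linePt_Dset p f v j 1
  rw [Dbig_apply, map_add, map_mul, map_mul _ _ (pderiv (0, j, 1) P), h0, h1, add_mul, add_mul,
    mul_assoc, mul_assoc]
  simp only [Polynomial.coeff_add, Polynomial.coeff_C_mul, Polynomial.coeff_X_pow_mul',
    if_neg hm.not_ge, zero_add]

theorem aeval_linePt_euler (p f : ℕ) [NeZero f] {K : Type*} [Field K]
    (v : Fin 2 → K) {r : Fin 2 × Fin f → ℕ} {P : MvPolynomial (Fin 2 × Fin f × Fin 2) K}
    (hP : IsMDegBig f r P) (j : Fin f) (hj : j ≠ 0) :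
    (v 0 ^ p ^ f) ^ p ^ (j : ℕ) • aeval (linePt p f v) (pderiv (0, j, 0) P) +
      (v 1 ^ p ^ f) ^ p ^ (j : ℕ) • aeval (linePt p f v) (pderiv (0, j, 1) P) =
      r (0, j) • aeval (linePt p f v) P := by
  have h := congrArg (aeval (linePt p f v)) (hP.euler 0 j)
  simpa [linePt, hj, Polynomial.smul_eq_C_mul] using h

theorem aeval_evPt_euler (p f : ℕ) [NeZero f] {K : Type*} [Field K]
    (v : Fin 2 → K) {r : Fin 2 × Fin f → ℕ} {P : MvPolynomial (Fin 2 × Fin f × Fin 2) K}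
    (hP : IsMDegBig f r P) (j : Fin f) :
    v 0 ^ p ^ (j : ℕ) * aeval (evPt p f v) (pderiv (0, j, 0) P) +
      v 1 ^ p ^ (j : ℕ) * aeval (evPt p f v) (pderiv (0, j, 1) P) =
      r (0, j) • aeval (evPt p f v) P := by
  have h := congrArg (aeval (evPt p f v)) (hP.euler 0 j)
  simpa [evPt] using h

theorem derivative_aeval_linePt (p f : ℕ) [NeZero f] {K : Type*} [Field K]
    (v : Fin 2 → K) (P : MvPolynomial (Fin 2 × Fin f × Fin 2) K) :
    Polynomial.derivative (aeval (linePt p f v) P) =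
      v 0 • aeval (linePt p f v) (pderiv (0, 0, 0) P) +
        v 1 • aeval (linePt p f v) (pderiv (0, 0, 1) P) := by
  rw [derivative_aeval_mvPolynomial, Fintype.sum_prod_type, Finset.sum_eq_single 0,
    Fintype.sum_prod_type, Finset.sum_eq_single 0, Fin.sum_univ_two]
  · simp only [linePt, and_self, if_true, Polynomial.derivative_add, Polynomial.derivative_C_mul,
      Polynomial.derivative_X, mul_one, Polynomial.derivative_C, add_zero,
      Polynomial.smul_eq_C_mul]
    ring
  · intro b _ hb
    simp only [linePt, hb, and_false, if_false, Polynomial.derivative_C, mul_zero,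
      Finset.sum_const_zero]
  · simp
  · intro b _ hb
    simp only [linePt, hb, false_and, if_false, Polynomial.derivative_C, mul_zero,
      Finset.sum_const_zero]
  · simp

theorem cuspFunctional_Dbig (p f : ℕ) [NeZero f] [Fact p.Prime] {r0 : ℕ} (hr0 : 2 ≤ r0)
    (hr0' : r0 ≤ p - 1) {K : Type*} [Field K] [CharP K p] (hK : ∀ a : K, (a ^ p ^ f) ^ p ^ f = a)
    (v : Fin 2 → K) (j : Fin f) {P : MvPolynomial (Fin 2 × Fin f × Fin 2) K}
    (hP : IsMDegBig f (fun sl => if sl.1 = 0 then ddegMain p f r0 j sl.2 else p - 1) P) :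
    cuspFunctional p f r0 v (Dbig p f K j P) = 0 := by
  have hp : 1 ≤ p := (Fact.out : p.Prime).one_le
  have hE : aeval (evPt p f v) (Dbig p f K j P) =
      v 0 ^ p ^ (if j = 0 then f else (j : ℕ)) * aeval (evPt p f v) (pderiv (0, j, 0) P) +
      v 1 ^ p ^ (if j = 0 then f else (j : ℕ)) * aeval (evPt p f v) (pderiv (0, j, 1) P) := by
    rw [Dbig_apply, map_add, map_mul, map_mul _ _ (pderiv (0, j, 1) P),
      aeval_evPt_Dset p f hp, aeval_evPt_Dset p f hp]
  rw [cuspFunctional_apply, hE, coeff_aeval_linePt_Dbig p f v j P (by omega : r0 - 2 < p)]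
  by_cases hj : j = 0
  · subst hj
    obtain ⟨m, rfl⟩ := Nat.exists_eq_add_of_le' hr0
    simp only [if_true, hK, Nat.add_sub_cancel]
    have hdeg : ∀ i, IsMDegBig f (fun sl => if sl.1 = 0 then if sl.2 = 0 then m + 1 else 0
        else p - 1) (pderiv (0, 0, i) P) := by
      intro i
      rw [isMDegBig_iff] at hP ⊢
      refine hP.pderiv ?_
      funext ⟨s, l⟩
      by_cases hs : s = 0 <;> by_cases hl : l = 0 <;>
        simp [bigWeight, ddegMain, hs, hl]
    have hlead : ∀ i, (aeval (linePt p f v) (pderiv (0, 0, i) P)).coeff (m + 1) =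
        aeval (evPt p f v) (pderiv (0, 0, i) P) := by
      intro i
      have := (hdeg i).coeff_aeval_linePt (p := p) v (fun l hl => by simp [hl])
      simpa using this
    have heuler := congrArg (aeval (linePt p f v)) (hP.euler 0 0)
    have hder := derivative_aeval_linePt p f v P
    set A0 := aeval (linePt p f v) (pderiv (0, 0, 0) P)
    set A1 := aeval (linePt p f v) (pderiv (0, 0, 1) P)
    set Q := aeval (linePt p f v) P
    have h1 : Polynomial.X * Polynomial.derivative Q +
        ((v 0 ^ p ^ f) • A0 + (v 1 ^ p ^ f) • A1) = (m + 2) • Q := by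
      rw [hder]
      have : ddegMain p f (m + 2) 0 0 = m + 2 := by simp [ddegMain]
      simp only [if_true, this, map_add, map_mul, aeval_X, map_nsmul] at heuler
      rw [← heuler]
      simp only [linePt, and_self, if_true, Polynomial.smul_eq_C_mul]
      ring
    have h2 := congrArg (fun R => Polynomial.coeff R (m + 1)) h1
    have h3 := congrArg (fun R => Polynomial.coeff R m) hder
    simp only [Polynomial.coeff_add, Polynomial.coeff_X_mul, Polynomial.coeff_derivative,
      Polynomial.coeff_smul, smul_eq_mul] at h2 h3
    rw [nsmul_eq_mul] at h2
    rw [← h3, ← hlead 0, ← hlead 1]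
    push_cast at h2 ⊢
    linear_combination (m + 1 : K) * h2
  · have h1 := aeval_evPt_euler p f v hP j
    have h2 := congrArg (fun R => Polynomial.coeff R (r0 - 2)) (aeval_linePt_euler p f v hP j hj)
    have h3 : ddegMain p f r0 j j = p := by simp [ddegMain, hj]
    simp only [if_true, h3, nsmul_eq_mul, CharP.cast_eq_zero, zero_mul, Polynomial.coeff_add,
      Polynomial.coeff_smul, smul_eq_mul, Polynomial.coeff_zero] at h1 h2
    rw [if_neg hj, h1, h2]
    ring

theorem cuspFunctional_eq_zero_of_mem_NBig (p f : ℕ) [NeZero f] [Fact p.Prime] {r0 : ℕ}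
    (hr0 : 2 ≤ r0) (hr0' : r0 ≤ p - 1) {K : Type*} [Field K] [CharP K p]
    (hK : ∀ a : K, (a ^ p ^ f) ^ p ^ f = a) (v : Fin 2 → K)
    {R : MvPolynomial (Fin 2 × Fin f × Fin 2) K} (hR : R ∈ NBig p f K r0) :
    cuspFunctional p f r0 v R = 0 := by
  rw [← LinearMap.mem_ker]
  refine Submodule.span_le.2 ?_ hR
  rintro _ hx
  obtain ⟨j, P, hP, rfl⟩ := Set.mem_iUnion.1 hx
  exact cuspFunctional_Dbig p f hr0 hr0' hK v j hP

/-! ### Monomials modulo the images of the Serre operators -/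

/-- The exponent of multidegree `r` with `Y`-part `e`. -/
noncomputable def bigExp (f : ℕ) (r e : Fin 2 × Fin f → ℕ) : Fin 2 × Fin f × Fin 2 →₀ ℕ :=
  Finsupp.equivFunOnFinite.symm fun w =>
    if w.2.2 = 0 then r (w.1, w.2.1) - e (w.1, w.2.1) else e (w.1, w.2.1)

theorem bigExp_apply (f : ℕ) (r e : Fin 2 × Fin f → ℕ) (s : Fin 2) (l : Fin f) (i : Fin 2) :
    bigExp f r e (s, l, i) = if i = 0 then r (s, l) - e (s, l) else e (s, l) := rfl

theorem isMDegBig_monomial {K : Type*} [CommRing K] {f : ℕ} {r e : Fin 2 × Fin f → ℕ}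
    (he : ∀ sl, e sl ≤ r sl) (a : K) : IsMDegBig f r (monomial (bigExp f r e) a) := by
  intro d hd s l
  rw [Finset.mem_singleton.1 (support_monomial_subset hd)]
  simp [bigExp_apply, Nat.sub_add_cancel (he (s, l))]

theorem bigExp_eq_self {f : ℕ} {r : Fin 2 × Fin f → ℕ} {d : Fin 2 × Fin f × Fin 2 →₀ ℕ}
    (hd : ∀ s l, d (s, l, 0) + d (s, l, 1) = r (s, l)) :
    bigExp f r (fun sl => d (sl.1, sl.2, 1)) = d := by
  ext ⟨s, l, i⟩
  rw [bigExp_apply, ← hd s l]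
  fin_cases i <;> simp

/-- The multidegree of the source of `D_j` in the big ring. -/
def srcDeg (p f : ℕ) [NeZero f] (r0 : ℕ) (j : Fin f) (sl : Fin 2 × Fin f) : ℕ :=
  if sl.1 = 0 then ddegMain p f r0 j sl.2 else p - 1

/-- The effect of the second summand of `D_j` on the `Y`-part of an exponent. -/
def shiftExp (p f : ℕ) [NeZero f] (j : Fin f) (e : Fin 2 × Fin f → ℕ) (sl : Fin 2 × Fin f) : ℕ :=
  if sl.1 = 0 then
    (e sl + if sl.2 = 0 then p else if sl.2 ∈ Dset f j then p - 1 else 0) -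
      if sl.2 = j then 1 else 0
  else e sl

theorem Dset_monomial (p f : ℕ) [NeZero f] (K : Type*) [CommRing K] (j : Fin f) (i : Fin 2) :
    ∃ d : Fin 2 × Fin f × Fin 2 →₀ ℕ,
      (X (0, 0, i) ^ p * ∏ l ∈ Dset f j, X (0, l, i) ^ (p - 1) :
        MvPolynomial (Fin 2 × Fin f × Fin 2) K) = monomial d 1 ∧
      ∀ s l i', d (s, l, i') = if s = 0 ∧ i' = i then
        (if l = 0 then p else if l ∈ Dset f j then p - 1 else 0) else 0 := by
  classical
  refine ⟨Finsupp.single (0, 0, i) p + ∑ l ∈ Dset f j, Finsupp.single (0, l, i) (p - 1), ?_, ?_⟩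
  · rw [← one_mul (1 : K), ← monomial_mul, monomial_sum_one]
    simp [X_pow_eq_monomial]
  · intro s l i'
    simp only [Finsupp.add_apply, Finsupp.finsetSum_apply, Finsupp.single_apply, Prod.ext_iff]
    by_cases hs : s = 0 ∧ i' = i
    · obtain ⟨rfl, rfl⟩ := hs
      by_cases hl : l = 0
      · subst hl
        have : (0 : Fin f) ∉ Dset f j := fun h => ne_zero_of_mem_Dset h rfl
        simp [this]
      · simp [hl, Ne.symm hl]
    · rw [if_neg hs]
      have : ∀ l' : Fin f, ¬ ((0 : Fin 2) = s ∧ l' = l ∧ i = i') := fun l' h =>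
        hs ⟨h.1.symm, h.2.2.symm⟩
      simp [this]

theorem Dbig_monomial (p f : ℕ) [NeZero f] (hp : 1 ≤ p) (r0 : ℕ) (hr0 : 1 ≤ r0) (K : Type*)
    [CommRing K] (j : Fin f) (e : Fin 2 × Fin f → ℕ) (he : ∀ sl, e sl ≤ srcDeg p f r0 j sl) :
    Dbig p f K j (monomial (bigExp f (srcDeg p f r0 j) e) 1) =
      monomial (bigExp f (bigDeg p f r0) e) ((srcDeg p f r0 j (0, j) - e (0, j) : ℕ) : K) +
      monomial (bigExp f (bigDeg p f r0) (shiftExp p f j e)) ((e (0, j) : ℕ) : K) := by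
  obtain ⟨d0, h0, hd0⟩ := Dset_monomial p f K j 0
  obtain ⟨d1, h1, hd1⟩ := Dset_monomial p f K j 1
  rw [Dbig_apply, h0, h1, pderiv_monomial, pderiv_monomial, monomial_mul, monomial_mul]
  simp only [one_mul]
  congr 1
  · rw [bigExp_apply, if_pos rfl]
    by_cases hz : srcDeg p f r0 j (0, j) - e (0, j) = 0
    · rw [hz]
      simp
    · refine congrArg (fun d => monomial d _) (Finsupp.ext fun ⟨s, l, i⟩ => ?_)
      have h := he (s, l)
      simp only [Finsupp.add_apply, Finsupp.tsub_apply, hd0, bigExp_apply, Finsupp.single_apply,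
        Prod.ext_iff, srcDeg, ddegMain, bigDeg, Dset] at h hz ⊢
      by_cases hs : s = 0
      · subst hs
        by_cases hi : i = 0
        · subst hi
          by_cases hj : j = 0
          · subst hj
            by_cases hl : l = 0 <;> simp [hl, eq_comm (a := (0 : Fin f))] at h hz ⊢ <;> omega
          · by_cases hl : l = 0
            · subst hl
              simp [hj] at h hz ⊢
              omega
            · rcases lt_trichotomy l j with hlj | hlj | hlj
              · simp [hl, hj, hlj, hlj.ne'] at h hz ⊢
                omega
              · subst hlj
                simp [hl] at h hz ⊢
                omega
              · simp [hl, hj, hlj.not_gt, hlj.ne, hlj.ne'] at h hz ⊢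
        · simp [hi, Ne.symm hi]
      · simp [hs, Ne.symm hs]
  · rw [bigExp_apply, if_neg one_ne_zero]
    by_cases hz : e (0, j) = 0
    · rw [hz]
      simp
    · refine congrArg (fun d => monomial d _) (Finsupp.ext fun ⟨s, l, i⟩ => ?_)
      have h := he (s, l)
      simp only [Finsupp.add_apply, Finsupp.tsub_apply, hd1, bigExp_apply, Finsupp.single_apply,
        Prod.ext_iff, srcDeg, ddegMain, bigDeg, Dset, shiftExp] at h hz ⊢
      by_cases hs : s = 0
      · subst hs
        have hi : i = 0 ∨ i = 1 := by omega
        by_cases hj : j = 0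
        · subst hj
          rcases hi with rfl | rfl <;>
          by_cases hl : l = 0 <;> simp [hl, eq_comm (a := (0 : Fin f))] at h hz ⊢ <;> omega
        · by_cases hl : l = 0
          · subst hl
            rcases hi with rfl | rfl <;>
            simp [hj, Ne.symm hj] at h hz ⊢ <;> omega
          · rcases lt_trichotomy l j with hlj | hlj | hlj
            · rcases hi with rfl | rfl <;>
              simp [hl, hj, hlj, hlj.ne, hlj.ne'] at h hz ⊢ <;> omega
            · subst hlj
              rcases hi with rfl | rfl <;>
              simp [hl] at h hz ⊢ <;> omega
            · rcases hi with rfl | rfl <;>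
              simp [hl, hj, hlj.not_gt, hlj.ne, hlj.ne'] at h hz ⊢
      · simp [hs, Ne.symm hs]

theorem Dbig_relation_mem_NBig (p f : ℕ) [NeZero f] (hp : 1 ≤ p) (r0 : ℕ) (hr0 : 1 ≤ r0)
    (K : Type*) [CommRing K] (j : Fin f) (e : Fin 2 × Fin f → ℕ)
    (he : ∀ sl, e sl ≤ srcDeg p f r0 j sl) :
    ((srcDeg p f r0 j (0, j) - e (0, j) : ℕ) : K) • monomial (bigExp f (bigDeg p f r0) e) (1 : K) +
      ((e (0, j) : ℕ) : K) • monomial (bigExp f (bigDeg p f r0) (shiftExp p f j e)) (1 : K) ∈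
        NBig p f K r0 := by
  rw [smul_monomial, smul_monomial, smul_eq_mul, smul_eq_mul, mul_one, mul_one,
    ← Dbig_monomial p f hp r0 hr0 K j e he]
  exact Submodule.subset_span (Set.mem_iUnion.2 ⟨j, _, isMDegBig_monomial he 1, rfl⟩)

/-- The exponents of the monomials forming a basis of the quotient by the images of the Serre
operators. -/
def IsStandard (p f : ℕ) (e : Fin 2 × Fin f → ℕ) : Prop :=
  (∀ sl, e sl ≤ p - 1) ∧ ∃ l, e (0, l) ≠ 0

/-- The span of the standard monomials. -/
noncomputable def standardSpan (p f : ℕ) [NeZero f] (K : Type*) [CommRing K] (r0 : ℕ) :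
    Submodule K (MvPolynomial (Fin 2 × Fin f × Fin 2) K) :=
  Submodule.span K
    ((fun e => monomial (bigExp f (bigDeg p f r0) e) 1) '' {e | IsStandard p f e})

theorem monomial_mem_NBig_sup (p f : ℕ) [NeZero f] [Fact p.Prime] {r0 : ℕ} (hr0 : 2 ≤ r0)
    (hr0' : r0 ≤ p - 1) (K : Type*) [Field K] [CharP K p] (e : Fin 2 × Fin f → ℕ)
    (he : ∀ sl, e sl ≤ bigDeg p f r0 sl) :
    monomial (bigExp f (bigDeg p f r0) e) 1 ∈ NBig p f K r0 ⊔ standardSpan p f K r0 := by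
  have hp : 1 ≤ p := (Fact.out : p.Prime).one_le
  have hcast : ∀ n : ℕ, n ≠ 0 → n < p → (n : K) ≠ 0 := fun n h0 hn h =>
    h0 (Nat.eq_zero_of_dvd_of_lt ((CharP.cast_eq_zero_iff K p n).1 h) hn)
  have hstd : ∀ e, IsStandard p f e →
      monomial (bigExp f (bigDeg p f r0) e) (1 : K) ∈ NBig p f K r0 ⊔ standardSpan p f K r0 :=
    fun e h => Submodule.mem_sup_right (Submodule.subset_span ⟨e, h, rfl⟩)
  have he0 : e (0, 0) ≤ r0 + p - 1 := by simpa [bigDeg] using he (0, 0)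
  have hel : ∀ l, l ≠ 0 → e (0, l) ≤ p - 1 := fun l hl => by simpa [bigDeg, hl] using he (0, l)
  have he1 : ∀ l, e (1, l) ≤ p - 1 := fun l => by simpa [bigDeg] using he (1, l)
  -- using the second summand of a relation
  have hrel : ∀ (j : Fin f) (e' : Fin 2 × Fin f → ℕ), (∀ sl, e' sl ≤ srcDeg p f r0 j sl) →
      IsStandard p f e' → e' (0, j) ≠ 0 → e' (0, j) < p → shiftExp p f j e' = e →
      monomial (bigExp f (bigDeg p f r0) e) (1 : K) ∈
        NBig p f K r0 ⊔ standardSpan p f K r0 := by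
    intro j e' h1 h2 h3 h4 h5
    have h := Submodule.mem_sup_left (T := standardSpan p f K r0)
      (Dbig_relation_mem_NBig p f hp r0 (by omega) K j e' h1)
    rw [Submodule.add_mem_iff_right _ (Submodule.smul_mem _ _ (hstd e' h2)), h5] at h
    exact (Submodule.smul_mem_iff _ (hcast _ h3 h4)).1 h
  by_cases hA : ∀ l, e (0, l) = 0
  · refine Submodule.mem_sup_left ?_
    have h := Dbig_relation_mem_NBig p f hp r0 (by omega) K 0 e (by
      rintro ⟨s, l⟩
      by_cases hs : s = 0
      · subst hs
        simp [hA]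
      · obtain rfl : s = 1 := by omega
        simpa [srcDeg] using he1 l)
    have h0 : srcDeg p f r0 0 (0, 0) = r0 := by simp [srcDeg, ddegMain]
    rw [hA, h0, Nat.cast_zero, zero_smul, add_zero, Nat.sub_zero] at h
    exact (Submodule.smul_mem_iff _ (hcast _ (by omega) (by omega))).1 h
  push Not at hA
  by_cases hD : e (0, 0) ≤ p - 1
  · refine hstd e ⟨?_, hA⟩
    rintro ⟨s, l⟩
    by_cases hs : s = 0
    · subst hs
      by_cases hl : l = 0
      · rwa [hl]
      · exact hel l hl
    · obtain rfl : s = 1 := by omega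
      exact he1 l
  by_cases hB : ∀ l, l ≠ 0 → e (0, l) = p - 1
  · refine hrel 0 (fun sl => if sl.1 = 0 then if sl.2 = 0 then e (0, 0) - (p - 1) else 0
      else e sl) ?_ ⟨?_, 0, ?_⟩ ?_ ?_ ?_
    · rintro ⟨s, l⟩
      by_cases hs : s = 0
      · by_cases hl : l = 0
        · simp [hs, hl, srcDeg, ddegMain]
          omega
        · simp [hs, hl]
      · obtain rfl : s = 1 := by omega
        simpa [srcDeg] using he1 l
    · rintro ⟨s, l⟩
      by_cases hs : s = 0
      · by_cases hl : l = 0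
        · simp [hs, hl]
          omega
        · simp [hs, hl]
      · obtain rfl : s = 1 := by omega
        simpa using he1 l
    · simp
      omega
    · simp
      omega
    · simp
      omega
    · funext ⟨s, l⟩
      by_cases hs : s = 0
      · subst hs
        by_cases hl : l = 0
        · subst hl
          simp [shiftExp]
          omega
        · simp [shiftExp, hl, Dset, hB l hl]
      · simp [shiftExp, hs]
  · push Not at hB
    obtain ⟨j, ⟨hj0, hjp⟩, hmin⟩ : ∃ j : Fin f, (j ≠ 0 ∧ e (0, j) ≠ p - 1) ∧
        ∀ l < j, l ≠ 0 → e (0, l) = p - 1 := by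
      obtain ⟨j, hj, hmin⟩ := WellFounded.has_min (wellFounded_lt (α := Fin f))
        {l | l ≠ 0 ∧ e (0, l) ≠ p - 1} hB
      refine ⟨j, hj, fun l hl hl0 => ?_⟩
      by_contra h
      exact hmin l ⟨hl0, h⟩ hl
    have hj := hel j hj0
    refine hrel j (fun sl => if sl.1 = 0 then if sl.2 = 0 then e (0, 0) - p
      else if sl.2 < j then 0 else if sl.2 = j then e (0, j) + 1 else e sl else e sl)
      ?_ ⟨?_, j, ?_⟩ ?_ ?_ ?_
    · rintro ⟨s, l⟩
      by_cases hs : s = 0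
      · by_cases hl : l = 0
        · simp [hs, hl, hj0, srcDeg, ddegMain]
          omega
        · rcases lt_trichotomy l j with hlj | hlj | hlj
          · simp [hs, hl, hlj]
          · subst hlj
            simp [hs, hl, srcDeg, ddegMain]
            omega
          · simpa [hs, hl, hj0, hlj.not_gt, hlj.ne', srcDeg, ddegMain] using hel l hl
      · obtain rfl : s = 1 := by omega
        simpa [srcDeg] using he1 l
    · rintro ⟨s, l⟩
      by_cases hs : s = 0
      · by_cases hl : l = 0
        · simp [hs, hl]
          omega
        · rcases lt_trichotomy l j with hlj | hlj | hlj
          · simp [hs, hl, hlj]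
          · subst hlj
            simp [hs, hl]
            omega
          · simpa [hs, hl, hlj.not_gt, hlj.ne'] using hel l hl
      · obtain rfl : s = 1 := by omega
        simpa using he1 l
    · simp [hj0]
    · simp [hj0]
    · simp [hj0]
      omega
    · funext ⟨s, l⟩
      by_cases hs : s = 0
      · subst hs
        by_cases hl : l = 0
        · subst hl
          simp [shiftExp, Ne.symm hj0]
          omega
        · rcases lt_trichotomy l j with hlj | hlj | hlj
          · simp [shiftExp, hl, hlj, hlj.ne, Dset, hj0, hmin l hlj hl]
          · subst hlj
            simp [shiftExp, hl, Dset]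
          · simp [shiftExp, hl, hlj.not_gt, hlj.ne', Dset, hj0]
      · simp [shiftExp, hs]

theorem IsMDegBig.mem_NBig_sup (p f : ℕ) [NeZero f] [Fact p.Prime] {r0 : ℕ} (hr0 : 2 ≤ r0)
    (hr0' : r0 ≤ p - 1) {K : Type*} [Field K] [CharP K p]
    {R : MvPolynomial (Fin 2 × Fin f × Fin 2) K} (hR : IsMDegBig f (bigDeg p f r0) R) :
    R ∈ NBig p f K r0 ⊔ standardSpan p f K r0 := by
  rw [R.as_sum]
  refine Submodule.sum_mem _ fun d hd => ?_
  rw [← mul_one (coeff d R), ← smul_eq_mul, ← smul_monomial, ← bigExp_eq_self (hR d hd)]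
  refine Submodule.smul_mem _ _ (monomial_mem_NBig_sup p f hr0 hr0' K _ fun sl => ?_)
  rw [← hR d hd sl.1 sl.2]
  exact Nat.le_add_left _ _

/-! ### Power sums over a finite field -/

section PowerSums

variable {F L : Type*} [Field F] [Fintype F]

theorem FiniteField.sum_pow_card_sub_one : ∑ b : F, b ^ (Fintype.card F - 1) = -1 := by
  classical
  have h1 : 1 < Fintype.card F := Fintype.one_lt_card
  have h : ∀ b : F, b ^ (Fintype.card F - 1) = 1 - if b = 0 then 1 else 0 := by
    intro b
    by_cases hb : b = 0
    · simp [hb, zero_pow (by omega : Fintype.card F - 1 ≠ 0)]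
    · simp [hb, FiniteField.pow_card_sub_one_eq_one b hb]
  rw [Finset.sum_congr rfl fun b _ => h b, Finset.sum_sub_distrib]
  simp

variable [CommRing L] [Algebra F L]

theorem FiniteField.sum_eval_algebraMap (P : Polynomial L)
    (hP : P.natDegree ≤ Fintype.card F - 1) :
    ∑ b : F, P.eval (algebraMap F L b) = -P.coeff (Fintype.card F - 1) := by
  simp only [Polynomial.eval_eq_sum_range' (Nat.lt_succ_of_le hP)]
  rw [Finset.sum_comm, Finset.sum_range_succ, Finset.sum_eq_zero, zero_add]
  · rw [← Finset.mul_sum]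
    simp only [← map_pow]
    rw [← map_sum, FiniteField.sum_pow_card_sub_one]
    simp
  · intro i hi
    rw [← Finset.mul_sum]
    simp only [← map_pow]
    rw [← map_sum, FiniteField.sum_pow_lt_card_sub_one F i (Finset.mem_range.1 hi)]
    simp

theorem FiniteField.sum_add_pow [Nontrivial L] (p : ℕ) [Fact p.Prime] [CharP L p] {n : ℕ}
    (hF : Fintype.card F = p ^ n) (ε : L) (e : ℕ) (he : e ≤ Fintype.card F - 1) :
    ∑ b : F, (algebraMap F L b + ε) ^ (Fintype.card F - 1 + e) =
      -((if e = 0 then 1 else 0) + if e = Fintype.card F - 1 then 1 else 0) := by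
  have h1 : 1 < Fintype.card F := Fintype.one_lt_card
  rcases Nat.eq_zero_or_pos e with rfl | he0
  · have h := FiniteField.sum_eval_algebraMap (F := F) ((Polynomial.X + Polynomial.C ε) ^
      (Fintype.card F - 1)) (by
        rw [Polynomial.natDegree_pow_X_add_C])
    have hm := ((Polynomial.monic_X_add_C ε).pow (Fintype.card F - 1)).coeff_natDegree
    rw [Polynomial.natDegree_pow_X_add_C] at hm
    rw [hm] at h
    simp only [Polynomial.eval_pow, Polynomial.eval_add, Polynomial.eval_X, Polynomial.eval_C] at h
    rw [add_zero, h, if_pos rfl, if_neg (by omega)]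
    simp
  · obtain ⟨k, rfl⟩ := Nat.exists_eq_add_of_le' he0
    have hmon : ((Polynomial.X + Polynomial.C (ε ^ Fintype.card F)) *
        (Polynomial.X + Polynomial.C ε) ^ k).Monic :=
      (Polynomial.monic_X_add_C _).mul ((Polynomial.monic_X_add_C ε).pow k)
    have hdeg : ((Polynomial.X + Polynomial.C (ε ^ Fintype.card F)) *
        (Polynomial.X + Polynomial.C ε) ^ k).natDegree = k + 1 := by
      rw [(Polynomial.monic_X_add_C _).natDegree_mul ((Polynomial.monic_X_add_C ε).pow k),
        Polynomial.natDegree_pow_X_add_C, Polynomial.natDegree_X_add_C, add_comm]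
    have h := FiniteField.sum_eval_algebraMap (F := F) _ (hdeg.trans_le he)
    have hb : ∀ b : F, (algebraMap F L b + ε) ^ (Fintype.card F - 1 + (k + 1)) =
        ((Polynomial.X + Polynomial.C (ε ^ Fintype.card F)) *
        (Polynomial.X + Polynomial.C ε) ^ k).eval (algebraMap F L b) := by
      intro b
      have : algebraMap F L b + ε ^ Fintype.card F =
          (algebraMap F L b + ε) ^ Fintype.card F := by
        rw [hF, add_pow_char_pow, ← map_pow, ← hF, FiniteField.pow_card]
      simp only [Polynomial.eval_mul, Polynomial.eval_pow, Polynomial.eval_add, Polynomial.eval_X,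
        Polynomial.eval_C]
      rw [this, ← pow_add]
      congr 1
      omega
    rw [Finset.sum_congr rfl fun b _ => hb b, h, if_neg (Nat.succ_ne_zero k), zero_add]
    congr 1
    split_ifs with hk
    · rw [← hk, ← hdeg, hmon.coeff_natDegree]
    · exact Polynomial.coeff_eq_zero_of_natDegree_lt (by omega)

theorem FiniteField.sum_pow_mul_linear_pow [Nontrivial L] (p : ℕ) [Fact p.Prime] [CharP L p]
    {k : ℕ} (hF : Fintype.card F = p ^ k) (ε s t : L) (m n : ℕ)
    (hmn : m + n ≤ Fintype.card F - 1) :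
    ∑ b : F, (algebraMap F L b + ε) ^ (Fintype.card F - 1 + m) *
        (s * (algebraMap F L b + ε) + t) ^ n =
      -((if m = 0 then t ^ n else 0) + if m + n = Fintype.card F - 1 then s ^ n else 0) := by
  have h1 : 1 < Fintype.card F := Fintype.one_lt_card
  have hb : ∀ b : F, (algebraMap F L b + ε) ^ (Fintype.card F - 1 + m) *
        (s * (algebraMap F L b + ε) + t) ^ n =
      ∑ i ∈ Finset.range (n + 1), s ^ i * t ^ (n - i) * (n.choose i) *
        (algebraMap F L b + ε) ^ (Fintype.card F - 1 + (m + i)) := by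
    intro b
    rw [add_pow (s * _) t n, Finset.mul_sum]
    refine Finset.sum_congr rfl fun i _ => ?_
    rw [mul_pow, ← add_assoc, pow_add _ _ i]
    ring
  rw [Finset.sum_congr rfl fun b _ => hb b, Finset.sum_comm]
  have hi : ∀ i ∈ Finset.range (n + 1), ∑ b : F, s ^ i * t ^ (n - i) * (n.choose i) *
        (algebraMap F L b + ε) ^ (Fintype.card F - 1 + (m + i)) =
      (if i = 0 then -(if m = 0 then t ^ n else 0) else 0) +
        (if i = n then -(if m + n = Fintype.card F - 1 then s ^ n else 0) else 0) := by
    intro i hi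
    have hin := Nat.lt_succ_iff.1 (Finset.mem_range.1 hi)
    rw [← Finset.mul_sum, FiniteField.sum_add_pow p hF ε (m + i) (by omega), neg_add, mul_add]
    congr 1
    · rcases Nat.eq_zero_or_pos i with rfl | hi0
      · simp
      · rw [if_neg (by omega), if_neg (by omega)]
        simp
    · by_cases hin' : i = n
      · subst hin'
        simp
      · rw [if_neg (by omega), if_neg hin']
        simp
  rw [Finset.sum_congr rfl hi, Finset.sum_add_distrib, Finset.sum_ite_eq', Finset.sum_ite_eq',
    if_pos (Finset.mem_range.2 (Nat.succ_pos n)), if_pos (Finset.mem_range.2 (Nat.lt_succ_self n)),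
    neg_add]

end PowerSums

section Separation

variable {F K : Type*} [Field F] [Fintype F] [DecidableEq F] [Field K] [Algebra F K]

theorem FiniteField.sum_range_units_pow (x : Fˣ) :
    ∑ c ∈ Finset.range (Fintype.card F - 1), (x : F) ^ (c + 1) = if x = 1 then -1 else 0 := by
  split_ifs with hx
  · subst hx
    have h1 : 1 ≤ Fintype.card F := Fintype.card_pos
    simp [Nat.cast_sub h1]
  · have hx' : (x : F) - 1 ≠ 0 := fun h => hx (Units.ext (sub_eq_zero.1 h))
    simp only [pow_succ]
    rw [← Finset.sum_mul]
    refine mul_eq_zero_of_left ?_ _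
    refine (mul_eq_zero.1 (?_ : _ * ((x : F) - 1) = 0)).resolve_right hx'
    rw [geom_sum_mul, FiniteField.pow_card_sub_one_eq_one _ x.ne_zero, sub_self]

theorem eq_zero_of_sum_mul_pow_eq_zero (u : Fˣ → K)
    (hu : ∀ c, 1 ≤ c → c ≤ Fintype.card F - 1 →
      ∑ d : Fˣ, u d * algebraMap F K d ^ c = 0) : u = 0 := by
  funext e
  have h : ∑ c ∈ Finset.range (Fintype.card F - 1),
      algebraMap F K (e⁻¹ : Fˣ) ^ (c + 1) * ∑ d : Fˣ, u d * algebraMap F K d ^ (c + 1) = 0 :=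
    Finset.sum_eq_zero fun c hc => by
      rw [hu (c + 1) (by omega) (by have := Finset.mem_range.1 hc; omega), mul_zero]
  simp only [Finset.mul_sum] at h
  rw [Finset.sum_comm, Finset.sum_congr rfl (g := fun d => u d * if d = e then -1 else 0)] at h
  · simpa using h
  · intro d _
    have : ∀ c, algebraMap F K (e⁻¹ : Fˣ) ^ (c + 1) * (u d * algebraMap F K d ^ (c + 1)) =
        u d * algebraMap F K (((e⁻¹ * d : Fˣ) : F) ^ (c + 1)) := by
      intro c
      rw [Units.val_mul, mul_pow, map_mul, map_pow, map_pow]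
      ring
    simp only [this]
    rw [← Finset.mul_sum, ← map_sum, FiniteField.sum_range_units_pow]
    simp only [inv_mul_eq_one, eq_comm (a := e)]
    split_ifs <;> simp

/-- A space of functions on `F × Fˣ` stable under translation in the first variable, and whose
integrals over the first variable contain all monomials, is everything. -/
theorem eq_top_of_translation_stable (I : Submodule K (F × Fˣ → K))
    (htr : ∀ φ ∈ I, ∀ s : F, (fun x : F × Fˣ => φ (x.1 + s, x.2)) ∈ I)
    (hmom : ∀ c, 1 ≤ c → c ≤ Fintype.card F - 1 → ∃ φ ∈ I, ∃ κ : K, κ ≠ 0 ∧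
      ∀ d : Fˣ, ∑ b : F, φ (b, d) = κ * algebraMap F K d ^ c) : I = ⊤ := by
  by_contra hI
  obtain ⟨Λ, hΛ, hker⟩ := Submodule.exists_le_ker_of_lt_top I (lt_top_iff_ne_top.2 hI)
  set w : F × Fˣ → K := fun x => Λ (Pi.single x 1) with hw
  have hΛw : ∀ φ, Λ φ = ∑ d : Fˣ, ∑ b : F, φ (b, d) * w (b, d) := by
    intro φ
    rw [LinearMap.pi_apply_eq_sum_univ Λ φ, Fintype.sum_prod_type, Finset.sum_comm]
    refine Finset.sum_congr rfl fun d _ => Finset.sum_congr rfl fun b _ => ?_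
    rw [smul_eq_mul, hw]
    congr 2
    funext x
    simp [Pi.single_apply, eq_comm]
  have hΛI : ∀ φ ∈ I, Λ φ = 0 := fun φ h => hker h
  let u : ℕ → F → Fˣ → K := fun k b d => ∑ x : F, algebraMap F K (x - b) ^ k * w (x, d)
  have hex : ∃ k, u k ≠ 0 := by
    by_contra! h
    refine hΛ (LinearMap.ext fun φ => ?_)
    rw [hΛw]
    refine Finset.sum_eq_zero fun d _ => Finset.sum_eq_zero fun b _ => ?_
    have h0 : u 0 b d - u (Fintype.card F - 1) b d = 0 := by rw [h, h]; simp
    have : w (b, d) = 0 := by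
      rw [← h0]
      simp only [u]
      rw [← Finset.sum_sub_distrib, Finset.sum_eq_single b]
      · have h1 : 1 < Fintype.card F := Fintype.one_lt_card
        simp [zero_pow (by omega : Fintype.card F - 1 ≠ 0)]
      · intro x _ hx
        rw [← map_pow, ← map_pow, FiniteField.pow_card_sub_one_eq_one _ (sub_ne_zero.2 hx)]
        simp
      · simp
    rw [this, mul_zero]
  obtain ⟨k, hk, hmin⟩ : ∃ k, u k ≠ 0 ∧ ∀ j < k, u j = 0 := by
    classical
    exact ⟨Nat.find hex, Nat.find_spec hex, fun j hj => not_not.1 (Nat.find_min hex hj)⟩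
  have hconst : ∀ b d, u k b d = u k 0 d := by
    intro b d
    have hx : ∀ x, algebraMap F K (x - b) ^ k = ∑ j ∈ Finset.range (k + 1),
        algebraMap F K x ^ j * (-algebraMap F K b) ^ (k - j) * (k.choose j : K) := fun x => by
      rw [map_sub, sub_eq_add_neg, add_pow]
    simp only [u, sub_zero, hx, Finset.sum_mul]
    rw [Finset.sum_comm, Finset.sum_range_succ, Finset.sum_eq_zero]
    · simp
    · intro j hj
      have := congrFun (congrFun (hmin j (Finset.mem_range.1 hj)) 0) d
      simp only [u, sub_zero, Pi.zero_apply] at this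
      rw [← mul_zero ((-algebraMap F K b) ^ (k - j) * (k.choose j : K)), ← this, Finset.mul_sum]
      refine Finset.sum_congr rfl fun x _ => ?_
      ring
  have hann : ∀ φ ∈ I, ∑ d : Fˣ, ∑ b : F, φ (b, d) * u k b d = 0 := by
    intro φ hφ
    have h : ∑ s : F, algebraMap F K s ^ k * Λ (fun x => φ (x.1 + -s, x.2)) = 0 :=
      Finset.sum_eq_zero fun s _ => by rw [hΛI _ (htr φ hφ (-s)), mul_zero]
    rw [← h]
    simp only [hΛw, Finset.mul_sum]
    conv_rhs => rw [Finset.sum_comm]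
    refine Finset.sum_congr rfl fun d _ => ?_
    simp only [u, Finset.mul_sum]
    rw [Finset.sum_comm]
    conv_rhs => rw [Finset.sum_comm]
    refine Finset.sum_congr rfl fun x _ => Fintype.sum_equiv (Equiv.subLeft x) _ _ fun b => ?_
    simp only [Equiv.subLeft_apply, ← sub_eq_add_neg, sub_sub_cancel]
    ring
  refine hk (funext fun b => ?_)
  have := eq_zero_of_sum_mul_pow_eq_zero (fun d => u k b d) fun c h1 h2 => by
    obtain ⟨φ, hφ, κ, hκ, hs⟩ := hmom c h1 h2
    have h := hann φ hφ
    have h' : κ * ∑ d : Fˣ, u k b d * algebraMap F K d ^ c = 0 := by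
      rw [← h, Finset.mul_sum]
      refine Finset.sum_congr rfl fun d _ => ?_
      rw [Finset.sum_congr rfl fun y _ => by rw [hconst y d, ← hconst b d],
        ← Finset.sum_mul, hs]
      ring
    exact (mul_eq_zero.1 h').resolve_left hκ
  exact this

end Separation

/-! ### Moments of the functional on standard monomials -/

theorem Polynomial.coeff_X_add_one_pow_char_add {K : Type*} [CommRing K] (p : ℕ) [Fact p.Prime]
    [CharP K p] (k : ℕ) {n : ℕ} (hn : n < p) :
    ((Polynomial.X + 1 : Polynomial K) ^ (p + k)).coeff n = k.choose n := by
  have : Nontrivial K := CharP.nontrivial_of_char_ne_one (Fact.out : p.Prime).ne_one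
  rw [pow_add, add_pow_char, one_pow, add_mul, one_mul, Polynomial.coeff_add,
    Polynomial.coeff_X_pow_mul', if_neg hn.not_ge, zero_add, Polynomial.coeff_X_add_one_pow]

theorem cuspFunctional_monomial (p f : ℕ) [NeZero f] (hp : 1 ≤ p) (r0 : ℕ) {K : Type*} [Field K]
    (v : Fin 2 → K) (hv : v 0 = 1) (e : Fin 2 × Fin f → ℕ) (he : ∀ l, e (1, l) = p - 1) :
    cuspFunctional p f r0 v (monomial (bigExp f (bigDeg p f r0) e) 1) =
      ((r0 : K) - 1) *
        ((v 1 ^ p ^ f) ^ (p ^ f - 1) * v 1 ^ ∑ l : Fin f, p ^ (l : ℕ) * e (0, l)) -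
      ((Polynomial.X + 1) ^ (r0 + p - 1 - e (0, 0)) *
        (Polynomial.C ((v 1 ^ p ^ f) ^
          (p ^ f - 1 + ∑ l ∈ Finset.univ.erase (0 : Fin f), p ^ (l : ℕ) * e (0, l))) *
        (Polynomial.C (v 1) * Polynomial.X + Polynomial.C (v 1 ^ p ^ f)) ^ e (0, 0))).coeff
          (r0 - 2) := by
  have hq : ∑ l : Fin f, p ^ (l : ℕ) * (p - 1) = p ^ f - 1 := by
    have := sum_pow_mul_pred p f hp
    omega
  rw [cuspFunctional_apply]
  congr 2
  · rw [aeval_monomial, map_one, one_mul, Finsupp.prod_fintype _ _ (by simp),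
      Fintype.prod_prod_type, Fin.prod_univ_two, Fintype.prod_prod_type, Fintype.prod_prod_type]
    simp only [Fin.prod_univ_two, evPt, bigExp_apply, hv, he, if_true, one_ne_zero, if_false,
      one_pow, one_mul]
    rw [mul_comm, ← hq, ← Finset.prod_pow_eq_pow_sum, ← Finset.prod_pow_eq_pow_sum]
    simp only [pow_mul]
  · rw [aeval_monomial, map_one, one_mul, Finsupp.prod_fintype _ _ (by simp),
      Fintype.prod_prod_type, Fin.prod_univ_two, Fintype.prod_prod_type, Fintype.prod_prod_type,
      ← Finset.mul_prod_erase Finset.univ _ (Finset.mem_univ (0 : Fin f))]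
    have h1 : ∀ l ∈ Finset.univ.erase (0 : Fin f), ∏ i : Fin 2,
        linePt p f v (0, l, i) ^ bigExp f (bigDeg p f r0) e (0, l, i) =
        Polynomial.C (v 1 ^ p ^ f) ^ (p ^ (l : ℕ) * e (0, l)) := by
      intro l hl
      simp [linePt, Finset.ne_of_mem_erase hl, hv, bigExp_apply, pow_mul]
    rw [Finset.prod_congr rfl h1, Finset.prod_pow_eq_pow_sum]
    have h2 : ∏ l : Fin f, ∏ i : Fin 2,
        linePt p f v (1, l, i) ^ bigExp f (bigDeg p f r0) e (1, l, i) =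
        Polynomial.C (v 1 ^ p ^ f) ^ (p ^ f - 1) := by
      rw [← hq, ← Finset.prod_pow_eq_pow_sum]
      refine Finset.prod_congr rfl fun l _ => ?_
      simp [linePt, hv, bigExp_apply, pow_mul, he]
    rw [h2, Fin.prod_univ_two]
    simp only [linePt, bigExp_apply, and_self, if_true, one_ne_zero, if_false, hv, one_pow,
      Polynomial.C_1, one_mul, bigDeg, Polynomial.C_pow, pow_add, Polynomial.C_mul]
    ring

theorem sum_cuspFunctional_monomial (p f : ℕ) [NeZero f] [Fact p.Prime] {r0 : ℕ} (hr0 : 2 ≤ r0)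
    (hr0' : r0 ≤ p - 1) {F K : Type*} [Field F] [Fintype F] [Field K] [Algebra F K] [CharP K p]
    (hF : Fintype.card F = p ^ f) {α : K} (hα : α ^ p ^ f ≠ α) (e : Fin 2 × Fin f → ℕ)
    (he : IsStandard p f e) (he1 : ∀ l, e (1, l) = p - 1) :
    ∃ κ : K, κ ≠ 0 ∧ ∀ d : F, ∑ b : F, cuspFunctional p f r0 (rowVec α !![1, b; 0, d])
        (monomial (bigExp f (bigDeg p f r0) e) 1) =
      κ * algebraMap F K d ^ ∑ l : Fin f, p ^ (l : ℕ) * e (0, l) := by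
  have hp : 1 ≤ p := (Fact.out : p.Prime).one_le
  set c := ∑ l : Fin f, p ^ (l : ℕ) * e (0, l) with hc
  set m := ∑ l ∈ Finset.univ.erase (0 : Fin f), p ^ (l : ℕ) * e (0, l) with hm
  have hcm : c = e (0, 0) + m := by
    rw [hc, hm, ← Finset.add_sum_erase Finset.univ _ (Finset.mem_univ (0 : Fin f))]
    simp
  have hcq : c ≤ Fintype.card F - 1 := by
    have h1 := sum_pow_mul_pred p f hp
    have h2 : c ≤ ∑ l : Fin f, p ^ (l : ℕ) * (p - 1) :=
      Finset.sum_le_sum fun l _ => Nat.mul_le_mul_left _ (he.1 (0, l))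
    omega
  have hc0 : c ≠ 0 := by
    obtain ⟨l, hl⟩ := he.2
    intro h
    have := (Finset.sum_eq_zero_iff.1 h) l (Finset.mem_univ l)
    exact hl ((mul_eq_zero.1 this).resolve_left (pow_ne_zero _ (by omega)))
  have hcast : ∀ n : ℕ, n ≠ 0 → n < p → (n : K) ≠ 0 := fun n h0 hn h =>
    h0 (Nat.eq_zero_of_dvd_of_lt ((CharP.cast_eq_zero_iff K p n).1 h) hn)
  obtain ⟨k, rfl⟩ := Nat.exists_eq_add_of_le' hr0
  set γ : K := if m = 0 then
    ((Polynomial.X + 1 : Polynomial K) ^ (k + 2 + p - 1 - e (0, 0)) *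
      Polynomial.X ^ e (0, 0)).coeff k else 0 with hγ
  have hκ : (k + 1 : K) - γ ≠ 0 := by
    have hk : ((k : K) + 1) ≠ 0 := by exact_mod_cast hcast (k + 1) (by omega) (by omega)
    rw [hγ]
    split_ifs with hm0
    · rw [Polynomial.coeff_mul_X_pow']
      split_ifs with hle
      · obtain ⟨n, rfl⟩ := Nat.exists_eq_add_of_le hle
        rw [show e (0, 0) + n + 2 + p - 1 - e (0, 0) = p + (n + 1) by omega,
          Polynomial.coeff_X_add_one_pow_char_add p _ (by omega), Nat.add_sub_cancel_left,
          Nat.choose_succ_self_right]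
        have := hcast (e (0, 0)) (by omega) (by omega)
        push_cast
        rwa [show (e (0, 0) : K) + n + 1 - (n + 1) = e (0, 0) by ring]
      · rwa [sub_zero]
    · rwa [sub_zero]
  refine ⟨-((k + 1 : K) - γ) * (α - α ^ p ^ f) ^ c,
    mul_ne_zero (neg_ne_zero.2 hκ) (pow_ne_zero _ (sub_ne_zero.2 hα.symm)), fun d => ?_⟩
  set ε : K := algebraMap F K d * α ^ p ^ f with hε
  set t : K := algebraMap F K d * (α - α ^ p ^ f) with ht
  have hz : ∀ b : F, rowVec α !![1, b; 0, d] 1 = 1 * (algebraMap F K b + ε) + t := by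
    intro b
    simp [rowVec, hε, ht]
    ring
  have hzq : ∀ b : F, rowVec α !![1, b; 0, d] 1 ^ p ^ f = algebraMap F K b + ε := by
    intro b
    simp only [rowVec, Matrix.of_apply, Matrix.cons_val', Matrix.cons_val_zero,
      Matrix.cons_val_one, Matrix.cons_val_fin_one]
    rw [add_pow_char_pow, mul_pow, ← map_pow, ← map_pow, ← hF, FiniteField.pow_card,
      FiniteField.pow_card, hF]
  have h1 := FiniteField.sum_pow_mul_linear_pow (F := F) p hF ε 1 t 0 c (by omega)
  have h2 := FiniteField.sum_pow_mul_linear_pow (F := F) p hF (Polynomial.C ε)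
    (Polynomial.X + 1) (Polynomial.C t * Polynomial.X) m (e (0, 0)) (by omega)
  have hterm : ∀ b : F, cuspFunctional p f (k + 2) (rowVec α !![1, b; 0, d])
        (monomial (bigExp f (bigDeg p f (k + 2)) e) 1) =
      (k + 1 : K) * ((algebraMap F K b + ε) ^ (Fintype.card F - 1 + 0) *
        (1 * (algebraMap F K b + ε) + t) ^ c) -
      ((Polynomial.X + 1) ^ (k + 2 + p - 1 - e (0, 0)) *
        ((algebraMap F (Polynomial K) b + Polynomial.C ε) ^ (Fintype.card F - 1 + m) *
        ((Polynomial.X + 1) * (algebraMap F (Polynomial K) b + Polynomial.C ε) +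
          Polynomial.C t * Polynomial.X) ^ e (0, 0))).coeff k := by
    intro b
    rw [cuspFunctional_monomial p f hp (k + 2) _ (by simp [rowVec]) e he1, hzq, hz, ← hF]
    congr 2
    · push_cast
      ring
    · rw [Polynomial.algebraMap_apply, ← Polynomial.C_add,
        ← Polynomial.C_pow]
      congr 3
      simp only [Polynomial.C_add, Polynomial.C_mul, Polynomial.C_1]
      ring
  rw [Finset.sum_congr rfl fun b _ => hterm b, Finset.sum_sub_distrib, ← Finset.mul_sum, h1,
    ← Polynomial.finsetSum_coeff, ← Finset.mul_sum, h2]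
  have h3 : ((Polynomial.X + 1 : Polynomial K) ^ (k + 2 + p - 1 - e (0, 0)) *
      (Polynomial.X + 1) ^ e (0, 0)).coeff k = (k : K) + 1 := by
    have := he.1 (0, 0)
    rw [← pow_add, show k + 2 + p - 1 - e (0, 0) + e (0, 0) = p + (k + 1) by omega,
      Polynomial.coeff_X_add_one_pow_char_add p _ (by omega), Nat.choose_succ_self_right]
    push_cast
    ring
  have h4 : ((Polynomial.X + 1 : Polynomial K) ^ (k + 2 + p - 1 - e (0, 0)) *
      (if m = 0 then (Polynomial.C t * Polynomial.X) ^ e (0, 0) else 0)).coeff k = γ * t ^ c := by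
    rw [hγ]
    split_ifs with hm0
    · rw [mul_pow, mul_left_comm, ← Polynomial.C_pow, Polynomial.coeff_C_mul, hcm, hm0, add_zero,
        mul_comm]
    · simp
  have h5 : ((Polynomial.X + 1 : Polynomial K) ^ (k + 2 + p - 1 - e (0, 0)) *
      (if m + e (0, 0) = Fintype.card F - 1 then (Polynomial.X + 1) ^ e (0, 0) else 0)).coeff k =
      if 0 + c = Fintype.card F - 1 then (k + 1 : K) else 0 := by
    rw [zero_add, hcm, add_comm m]
    split_ifs
    · exact h3
    · simp
  rw [mul_neg, mul_neg, Polynomial.coeff_neg, mul_add (_ : Polynomial K), Polynomial.coeff_add,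
    h4, h5, if_pos rfl, mul_assoc, ← mul_pow, mul_comm _ (algebraMap F K d), ← ht]
  split_ifs
  · rw [one_pow]
    ring
  · ring

/-! ### The kernel of the functionals on the component of multidegree `bigDeg` -/

theorem FiniteField.pow_card_ne_self {F K : Type*} [Field F] [Fintype F] [Field K] [Algebra F K]
    {α : K} (hα : α ∉ Set.range (algebraMap F K)) : α ^ Fintype.card F ≠ α := by
  classical
  intro h
  have h0 : (Polynomial.X ^ Fintype.card F - Polynomial.X : Polynomial K) ≠ 0 :=
    FiniteField.X_pow_card_sub_X_ne_zero K Fintype.one_lt_card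
  have h1 := Polynomial.card_roots' (Polynomial.X ^ Fintype.card F - Polynomial.X : Polynomial K)
  rw [FiniteField.X_pow_card_sub_X_natDegree_eq K Fintype.one_lt_card] at h1
  have h2 : insert α (Finset.univ.image (algebraMap F K)) ⊆
      (Polynomial.X ^ Fintype.card F - Polynomial.X : Polynomial K).roots.toFinset := by
    intro x hx
    rw [Multiset.mem_toFinset, Polynomial.mem_roots h0, Polynomial.IsRoot.def,
      Polynomial.eval_sub, Polynomial.eval_pow, Polynomial.eval_X, sub_eq_zero]
    rcases Finset.mem_insert.1 hx with rfl | hx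
    · exact h
    · obtain ⟨a, -, rfl⟩ := Finset.mem_image.1 hx
      rw [← map_pow, FiniteField.pow_card]
  have h3 := (Finset.card_le_card h2).trans (Multiset.toFinset_card_le _)
  rw [Finset.card_insert_of_notMem (by simpa using hα),
    Finset.card_image_of_injective _ (algebraMap F K).injective, Finset.card_univ] at h3
  omega

/-- The functionals attached to the matrices `[[1, b], [0, d]]`, which represent the cosets of
the torus. -/
noncomputable def cuspRestrict (p f : ℕ) [NeZero f] (r0 : ℕ) {F K : Type*} [Field F] [Field K]
    [Algebra F K] (α : K) : MvPolynomial (Fin 2 × Fin f × Fin 2) K →ₗ[K] (F × Fˣ → K) :=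
  LinearMap.pi fun x => cuspFunctional p f r0 (rowVec α !![1, x.1; 0, x.2])

theorem exists_isStandard_sum_eq (p f : ℕ) [Fact p.Prime] {c : ℕ} (hc : 1 ≤ c)
    (hc' : c ≤ p ^ f - 1) : ∃ e : Fin 2 × Fin f → ℕ, IsStandard p f e ∧
      (∀ l, e (1, l) = p - 1) ∧ ∑ l : Fin f, p ^ (l : ℕ) * e (0, l) = c := by
  have hp : 1 ≤ p := (Fact.out : p.Prime).one_le
  have hpf : 1 ≤ p ^ f := Nat.one_le_pow _ _ hp
  obtain ⟨a, ha⟩ := (finFunctionFinEquiv (m := p) (n := f)).surjective ⟨c, by omega⟩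
  have ha' : ∑ l : Fin f, (a l : ℕ) * p ^ (l : ℕ) = c := by
    rw [← finFunctionFinEquiv_apply, ha]
  refine ⟨fun sl => if sl.1 = 0 then a sl.2 else p - 1, ⟨fun sl => ?_, ?_⟩, ?_, ?_⟩
  · dsimp only
    split_ifs
    · have := (a sl.2).isLt
      omega
    · exact le_rfl
  · by_contra! h
    have : ∑ l : Fin f, (a l : ℕ) * p ^ (l : ℕ) = 0 :=
      Finset.sum_eq_zero fun l _ => by
        have := h l
        simp only [if_true] at this
        rw [this, zero_mul]
    omega
  · simp
  · simp only [if_true]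
    rw [← ha']
    exact Finset.sum_congr rfl fun l _ => mul_comm _ _

theorem cuspRestrict_surjective (p f : ℕ) [NeZero f] [Fact p.Prime] {r0 : ℕ} (hr0 : 2 ≤ r0)
    (hr0' : r0 ≤ p - 1) {F K : Type*} [Field F] [Fintype F] [Field K] [Algebra F K] [CharP K p]
    (hF : Fintype.card F = p ^ f) {α : K} (hα : α ^ p ^ f ≠ α) (h : F × Fˣ → K) :
    ∃ R, IsMDegBig f (bigDeg p f r0) R ∧ cuspRestrict p f r0 α R = h := by
  classical
  have htop : (weightedHomogeneousSubmodule K (bigWeight f) (bigDeg p f r0)).map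
      (cuspRestrict p f r0 (F := F) α) = ⊤ := by
    refine eq_top_of_translation_stable _ ?_ fun c hc hc' => ?_
    · rintro _ ⟨R, hR, rfl⟩ s
      refine ⟨actBig p f F K !![1, s; 0, 1] R,
        isMDegBig_iff.1 (isMDegBig_actBig (isMDegBig_iff.2 hR) _), ?_⟩
      funext x
      simp only [cuspRestrict, LinearMap.pi_apply]
      rw [cuspFunctional_actBig p f r0 fun a => by rw [← map_pow, ← hF, FiniteField.pow_card],
        ← rowVec_mul]
      simp [add_comm]
    · obtain ⟨e, he, he1, rfl⟩ := exists_isStandard_sum_eq p f hc (hF ▸ hc')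
      obtain ⟨κ, hκ, hsum⟩ := sum_cuspFunctional_monomial p f hr0 hr0' hF hα e he he1
      refine ⟨_, ⟨monomial (bigExp f (bigDeg p f r0) e) 1, ?_, rfl⟩, κ, hκ, fun d => hsum d⟩
      refine isMDegBig_iff.1 (isMDegBig_monomial (fun sl => (he.1 sl).trans ?_) _)
      unfold bigDeg
      split_ifs <;> omega
  obtain ⟨R, hR, hRh⟩ : h ∈ (weightedHomogeneousSubmodule K (bigWeight f) (bigDeg p f r0)).map
      (cuspRestrict p f r0 (F := F) α) := htop ▸ Submodule.mem_top
  exact ⟨R, isMDegBig_iff.2 hR, hRh⟩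

theorem finrank_standardSpan_le (p f : ℕ) [NeZero f] [Fact p.Prime] (r0 : ℕ) (K : Type*)
    [Field K] : Module.Finite K (standardSpan p f K r0) ∧
      Module.finrank K (standardSpan p f K r0) ≤ p ^ f * (p ^ f - 1) := by
  classical
  have : NeZero p := ⟨(Fact.out : p.Prime).ne_zero⟩
  have hp : 1 ≤ p := (Fact.out : p.Prime).one_le
  let b : {a : Fin f → Fin p // a ≠ 0} × (Fin f → Fin p) →
      MvPolynomial (Fin 2 × Fin f × Fin 2) K := fun a =>
    monomial (bigExp f (bigDeg p f r0) fun sl => if sl.1 = 0 then a.1.1 sl.2 else a.2 sl.2) 1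
  have hle : standardSpan p f K r0 ≤ Submodule.span K (Set.range b) := by
    refine Submodule.span_mono ?_
    rintro _ ⟨e, ⟨he, l, hl⟩, rfl⟩
    have hlt : ∀ sl, e sl < p := fun sl => by
      have := he sl
      omega
    refine ⟨(⟨fun l => ⟨e (0, l), hlt _⟩, fun h => hl ?_⟩, fun l => ⟨e (1, l), hlt _⟩), ?_⟩
    · exact congrArg Fin.val (congrFun h l)
    · simp only [b]
      congr 2
      refine congrArg _ (funext fun ⟨s, l⟩ => ?_)
      fin_cases s <;> rfl
  have hfin : Module.Finite K (Submodule.span K (Set.range b)) :=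
    FiniteDimensional.span_of_finite K (Set.finite_range b)
  refine ⟨Submodule.finiteDimensional_of_le hle, (Submodule.finrank_mono hle).trans ?_⟩
  refine (finrank_range_le_card b).trans_eq ?_
  rw [Fintype.card_prod, Fintype.card_subtype_compl, Fintype.card_subtype_eq, Fintype.card_fun,
    Fintype.card_fin, Fintype.card_fin, mul_comm]

theorem mem_NBig_of_cuspRestrict_eq_zero (p f : ℕ) [NeZero f] [Fact p.Prime] {r0 : ℕ}
    (hr0 : 2 ≤ r0) (hr0' : r0 ≤ p - 1) {F K : Type*} [Field F] [Fintype F] [Field K]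
    [Algebra F K] [CharP K p] (hF : Fintype.card F = p ^ f)
    (hK : ∀ a : K, (a ^ p ^ f) ^ p ^ f = a) {α : K} (hα : α ^ p ^ f ≠ α)
    {R : MvPolynomial (Fin 2 × Fin f × Fin 2) K} (hR : IsMDegBig f (bigDeg p f r0) R)
    (h0 : cuspRestrict p f r0 (F := F) α R = 0) : R ∈ NBig p f K r0 := by
  classical
  have hN : ∀ R ∈ NBig p f K r0, cuspRestrict p f r0 (F := F) α R = 0 := fun R hR =>
    funext fun x => cuspFunctional_eq_zero_of_mem_NBig p f hr0 hr0' hK _ hR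
  obtain ⟨hfin, hrank⟩ := finrank_standardSpan_le p f r0 K
  set ρ : standardSpan p f K r0 →ₗ[K] (F × Fˣ → K) :=
    (cuspRestrict p f r0 (F := F) α).domRestrict (standardSpan p f K r0) with hρ
  have hsurj : Function.Surjective ρ := by
    intro h
    obtain ⟨P, hP, rfl⟩ := cuspRestrict_surjective p f hr0 hr0' hF hα h
    obtain ⟨n, hn, s, hs, rfl⟩ := Submodule.mem_sup.1 (hP.mem_NBig_sup p f hr0 hr0')
    refine ⟨⟨s, hs⟩, ?_⟩
    rw [map_add, hN n hn, zero_add]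
    rfl
  have hcard : Module.finrank K (F × Fˣ → K) = p ^ f * (p ^ f - 1) := by
    rw [Module.finrank_fintype_fun_eq_card, Fintype.card_prod, Fintype.card_units, hF]
  have hinj : Function.Injective ρ := by
    refine (LinearMap.injective_iff_surjective_of_finrank_eq_finrank
      (le_antisymm (hrank.trans_eq hcard.symm) ?_)).2 hsurj
    exact LinearMap.finrank_le_finrank_of_surjective hsurj
  obtain ⟨n, hn, s, hs, rfl⟩ := Submodule.mem_sup.1 (hR.mem_NBig_sup p f hr0 hr0')
  rw [map_add, hN n hn, zero_add] at h0
  have hs0 : (⟨s, hs⟩ : standardSpan p f K r0) = 0 := hinj (h0.trans (map_zero ρ).symm)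
  rw [show s = 0 from congrArg Subtype.val hs0, add_zero]
  exact hn

/-! ### The span of the images of the Serre operators is stable -/

theorem le_bigDeg_of_le_srcDeg {p f : ℕ} [NeZero f] {r0 : ℕ} (hp : 1 ≤ p) {j : Fin f}
    {e : Fin 2 × Fin f → ℕ} (he : ∀ sl, e sl ≤ srcDeg p f r0 j sl)
    (hj : e (0, j) < srcDeg p f r0 j (0, j)) (sl : Fin 2 × Fin f) :
    e sl ≤ bigDeg p f r0 sl := by
  obtain ⟨s, l⟩ := sl
  have h1 := he (s, l)
  simp only [srcDeg, ddegMain, bigDeg] at *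
  by_cases hs : s = 0
  · subst hs
    by_cases hlj : l = j
    · subst hlj
      by_cases hl : l = 0 <;> simp [hl] at * <;> omega
    · by_cases hl : l = 0 <;> by_cases hj0 : j = 0 <;> simp [hl, hj0, hlj] at h1 ⊢
      · omega
      · omega
      · omega
      · split_ifs at h1 <;> omega
  · simpa [hs] using h1

theorem shiftExp_le_bigDeg {p f : ℕ} [NeZero f] {r0 : ℕ} (hp : 1 ≤ p) (hr0 : 1 ≤ r0) {j : Fin f}
    {e : Fin 2 × Fin f → ℕ} (he : ∀ sl, e sl ≤ srcDeg p f r0 j sl)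
    (hj : e (0, j) ≠ 0) (sl : Fin 2 × Fin f) :
    shiftExp p f j e sl ≤ bigDeg p f r0 sl := by
  obtain ⟨s, l⟩ := sl
  have h1 := he (s, l)
  simp only [srcDeg, ddegMain, bigDeg, shiftExp, Dset] at *
  by_cases hs : s = 0
  · subst hs
    by_cases hlj : l = j
    · subst hlj
      by_cases hl : l = 0 <;> simp [hl] at * <;> omega
    · by_cases hl : l = 0
      · subst hl
        simp [hlj, Ne.symm hlj] at h1 ⊢
        omega
      · by_cases hj0 : j = 0 <;> simp [hl, hj0, hlj] at h1 ⊢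
        · omega
        · split_ifs at h1 ⊢ <;> omega
  · simpa [hs] using h1

theorem isMDegBig_of_mem_NBig (p f : ℕ) [NeZero f] (hp : 1 ≤ p) {r0 : ℕ} (hr0 : 1 ≤ r0)
    {K : Type*} [CommRing K] {R : MvPolynomial (Fin 2 × Fin f × Fin 2) K}
    (hR : R ∈ NBig p f K r0) : IsMDegBig f (bigDeg p f r0) R := by
  rw [isMDegBig_iff, ← mem_weightedHomogeneousSubmodule]
  refine Submodule.span_le.2 ?_ hR
  rintro _ hx
  obtain ⟨j, P, hP, rfl⟩ := Set.mem_iUnion.1 hx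
  rw [P.as_sum, map_sum]
  refine Submodule.sum_mem _ fun d hd => ?_
  rw [← mul_one (coeff d P), ← smul_eq_mul, ← smul_monomial, map_smul]
  refine Submodule.smul_mem _ _ ?_
  have hd' : ∀ s l, d (s, l, 0) + d (s, l, 1) = srcDeg p f r0 j (s, l) := hP d hd
  set e : Fin 2 × Fin f → ℕ := fun sl => d (sl.1, sl.2, 1) with he
  have hle : ∀ sl, e sl ≤ srcDeg p f r0 j sl := fun sl => by
    rw [← hd' sl.1 sl.2]
    exact Nat.le_add_left _ _
  rw [← bigExp_eq_self hd', Dbig_monomial p f hp r0 hr0 K j e hle]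
  have hbig : ∀ e' : Fin 2 × Fin f → ℕ, ∀ n : ℕ,
      (n ≠ 0 → ∀ sl, e' sl ≤ bigDeg p f r0 sl) →
      monomial (bigExp f (bigDeg p f r0) e') (n : K) ∈
        weightedHomogeneousSubmodule K (bigWeight f) (bigDeg p f r0) := by
    intro e' n h
    by_cases hn : n = 0
    · simp [hn]
    · exact isMDegBig_iff.1 (isMDegBig_monomial (h hn) _)
  refine Submodule.add_mem _ (hbig _ _ fun hn ⟨s, l⟩ => ?_) (hbig _ _ fun hn ⟨s, l⟩ => ?_)
  · exact le_bigDeg_of_le_srcDeg hp hle (by omega) _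
  · exact shiftExp_le_bigDeg hp hr0 hle hn _

/-- The inclusion of the first tensor factor. -/
noncomputable def inclMain (f : ℕ) (K : Type*) [CommRing K] :
    MvPolynomial (Fin f × Fin 2) K →ₐ[K] MvPolynomial (Fin 2 × Fin f × Fin 2) K :=
  rename fun v => (0, v)

/-- The vector `⊗_j X_j^{p-1}` of the second tensor factor. -/
noncomputable def topVec (p f : ℕ) (K : Type*) [CommRing K] :
    MvPolynomial (Fin 2 × Fin f × Fin 2) K :=
  ∏ l : Fin f, X (1, l, 0) ^ (p - 1)

/-- Evaluation of the second tensor factor at a point. -/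
noncomputable def evSnd (f : ℕ) {K : Type*} [CommRing K] (z : Fin 2 → K) :
    MvPolynomial (Fin 2 × Fin f × Fin 2) K →ₐ[K] MvPolynomial (Fin f × Fin 2) K :=
  aeval fun w => if w.1 = 0 then X w.2 else C (z w.2.2)

theorem pderiv_topVec (p f : ℕ) (K : Type*) [CommRing K] (j : Fin f) (i : Fin 2) :
    pderiv (0, j, i) (topVec p f K) = 0 := by
  refine Finset.prod_induction _ (fun P => pderiv (0, j, i) P = 0) (fun P Q hP hQ => ?_) ?_
    fun l _ => ?_
  · rw [pderiv_mul, hP, hQ, zero_mul, mul_zero, add_zero]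
  · exact pderiv_one
  · rw [pderiv_pow, pderiv_X_of_ne (by simp), mul_zero]

theorem Dbig_inclMain_mul_topVec (p f : ℕ) [NeZero f] (K : Type*) [CommRing K] (j : Fin f)
    (P : MvPolynomial (Fin f × Fin 2) K) :
    Dbig p f K j (inclMain f K P * topVec p f K) =
      inclMain f K (Dmain p f K j P) * topVec p f K := by
  have h : ∀ i, pderiv (0, j, i) (inclMain f K P * topVec p f K) =
      inclMain f K (pderiv (j, i) P) * topVec p f K := by
    intro i
    rw [pderiv_mul, pderiv_topVec, mul_zero, add_zero, inclMain,
      pderiv_rename (Prod.mk_right_injective 0)]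
  rw [Dbig_apply, h, h]
  simp only [Dmain, LinearMap.add_apply, LinearMap.comp_apply, LinearMap.mulLeft_apply,
    Derivation.coeFn_coe, map_add, map_mul, map_pow, map_prod]
  simp only [inclMain, rename_X]
  ring

theorem isMDegBig_inclMain_mul_topVec (p f : ℕ) {K : Type*} [CommRing K] {r : Fin f → ℕ}
    {P : MvPolynomial (Fin f × Fin 2) K} (hP : IsMDegMain f r P) :
    IsMDegBig f (fun sl => if sl.1 = 0 then r sl.2 else p - 1)
      (inclMain f K P * topVec p f K) := by
  rw [isMDegMain_iff] at hP
  let L : (Fin f → ℕ) →+ (Fin 2 × Fin f → ℕ) :=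
    { toFun := fun r sl => if sl.1 = 0 then r sl.2 else 0
      map_zero' := by ext; simp
      map_add' := fun a b => by
        ext sl
        by_cases h : sl.1 = 0 <;> simp [h] }
  have h1 : IsWeightedHomogeneous (bigWeight f) (inclMain f K P) (L r) := by
    have : inclMain f K = aeval fun v => X (0, v) := by
      ext
      simp [inclMain]
    rw [this]
    refine hP.aeval_of_forall L _ fun v => ?_
    convert isWeightedHomogeneous_X K (bigWeight f) (0, v) using 1
    ext ⟨s, l⟩
    by_cases hs : s = 0 <;>
      simp [L, mainWeight, bigWeight, Pi.single_apply, hs]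
  have h2 : IsWeightedHomogeneous (bigWeight f) (topVec p f K)
      (∑ l : Fin f, (p - 1) • bigWeight f (1, l, 0)) :=
    IsWeightedHomogeneous.prod _ _ _ fun l _ => (isWeightedHomogeneous_X K _ _).pow _
  rw [isMDegBig_iff]
  convert h1.mul h2 using 1
  ext ⟨s, l⟩
  by_cases hs : s = 0
  · simp [L, bigWeight, hs]
  · obtain rfl : s = 1 := by omega
    simp [L, bigWeight, Pi.single_apply]

theorem inclMain_mul_topVec_mem_NBig (p f : ℕ) [NeZero f] {K : Type*} [CommRing K] {r0 : ℕ}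
    {x : MvPolynomial (Fin f × Fin 2) K} (hx : x ∈ NMain p f K r0) :
    inclMain f K x * topVec p f K ∈ NBig p f K r0 := by
  have : NMain p f K r0 ≤ (NBig p f K r0).comap
      (LinearMap.mulRight K (topVec p f K) ∘ₗ (inclMain f K).toLinearMap) := by
    refine Submodule.span_le.2 ?_
    intro y hy
    obtain ⟨j, P, hP, rfl⟩ := Set.mem_iUnion.1 hy
    refine Submodule.subset_span (Set.mem_iUnion.2 ⟨j, inclMain f K P * topVec p f K,
      isMDegBig_inclMain_mul_topVec p f hP, Dbig_inclMain_mul_topVec p f K j P⟩)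
  exact this hx

theorem pderiv_evSnd (f : ℕ) {K : Type*} [CommRing K] (z : Fin 2 → K) (v : Fin f × Fin 2)
    (P : MvPolynomial (Fin 2 × Fin f × Fin 2) K) :
    pderiv v (evSnd f z P) = evSnd f z (pderiv (0, v) P) := by
  classical
  induction P using MvPolynomial.induction_on with
  | C a => simp [evSnd]
  | add P Q hP hQ => simp only [map_add, hP, hQ]
  | mul_X P w h =>
    rw [map_mul, pderiv_mul, h, pderiv_mul, map_add, map_mul, map_mul]
    congr 2
    rw [evSnd, aeval_X, pderiv_X]
    obtain ⟨s, w⟩ := w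
    by_cases hs : s = 0
    · subst hs
      by_cases hv : v = w
      · subst hv
        simp
      · simp [pderiv_X, Ne.symm hv]
    · simp [hs]

theorem evSnd_Dbig (p f : ℕ) [NeZero f] {K : Type*} [CommRing K] (z : Fin 2 → K) (j : Fin f)
    (P : MvPolynomial (Fin 2 × Fin f × Fin 2) K) :
    evSnd f z (Dbig p f K j P) = Dmain p f K j (evSnd f z P) := by
  simp only [Dbig_apply, Dmain, LinearMap.add_apply, LinearMap.comp_apply,
    LinearMap.mulLeft_apply, Derivation.coeFn_coe, map_add, map_mul, map_pow, map_prod,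
    pderiv_evSnd]
  simp [evSnd]

theorem evSnd_mem_NMain (p f : ℕ) [NeZero f] {K : Type*} [CommRing K] (z : Fin 2 → K) {r0 : ℕ}
    {R : MvPolynomial (Fin 2 × Fin f × Fin 2) K} (hR : R ∈ NBig p f K r0) :
    evSnd f z R ∈ NMain p f K r0 := by
  have : NBig p f K r0 ≤ (NMain p f K r0).comap (evSnd f z).toLinearMap := by
    refine Submodule.span_le.2 ?_
    intro y hy
    obtain ⟨j, P, hP, rfl⟩ := Set.mem_iUnion.1 hy
    refine Submodule.subset_span (Set.mem_iUnion.2 ⟨j, evSnd f z P, ?_,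
      (evSnd_Dbig p f z j P).symm⟩)
    let L : (Fin 2 × Fin f → ℕ) →+ (Fin f → ℕ) :=
      { toFun := fun r l => r (0, l)
        map_zero' := rfl
        map_add' := fun _ _ => rfl }
    have hP' : IsMDegBig f (srcDeg p f r0 j) P := hP
    have h := (isMDegBig_iff.1 hP').aeval_of_forall (w' := mainWeight f) L
      (fun w => if w.1 = 0 then X w.2 else C (z w.2.2)) fun w => by
        obtain ⟨s, w⟩ := w
        by_cases hs : s = 0
        · rw [if_pos hs]
          convert isWeightedHomogeneous_X K (mainWeight f) w using 1
          ext l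
          simp [L, mainWeight, bigWeight, Pi.single_apply, hs]
        · rw [if_neg hs]
          convert isWeightedHomogeneous_C (mainWeight f) (z w.2) using 1
          ext l
          simp [L, bigWeight, Ne.symm hs]
    have hL : L (srcDeg p f r0 j) = ddegMain p f r0 j := by
      ext l
      simp [L, srcDeg]
    rw [hL] at h
    exact isMDegMain_iff.2 h
  exact this hR

theorem evSnd_actBig (p f : ℕ) {F K : Type*} [Field F] [CommRing K] [Algebra F K] (z : Fin 2 → K)
    (g : Matrix (Fin 2) (Fin 2) F) (x : MvPolynomial (Fin f × Fin 2) K) :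
    evSnd f z (actBig p f F K g (inclMain f K x * topVec p f K)) =
      (∏ l : Fin f, (algebraMap F K (g 0 0) ^ p ^ (l : ℕ) * z 0 +
        algebraMap F K (g 1 0) ^ p ^ (l : ℕ) * z 1) ^ (p - 1)) • actMain p f F K g x := by
  rw [actBig, AlgHom.toLinearMap_apply, map_mul, map_mul, mul_comm, smul_eq_C_mul]
  congr 1
  · simp only [topVec, map_prod, map_pow, aeval_X, map_add, map_mul]
    simp [evSnd]
  · rw [actMain, AlgHom.toLinearMap_apply, inclMain, aeval_rename, ← AlgHom.comp_apply,
      comp_aeval]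
    congr 2
    funext v
    simp [evSnd]

theorem actMain_mem_NMain (p f : ℕ) [NeZero f] [Fact p.Prime] {r0 : ℕ} (hr0 : 2 ≤ r0)
    (hr0' : r0 ≤ p - 1) {F K : Type*} [Field F] [Fintype F] [Field K] [Algebra F K] [CharP K p]
    (hF : Fintype.card F = p ^ f) (hK : ∀ a : K, (a ^ p ^ f) ^ p ^ f = a) {α : K}
    (hα : α ^ p ^ f ≠ α) {g : Matrix (Fin 2) (Fin 2) F} (hg : g 0 0 ≠ 0 ∨ g 1 0 ≠ 0)
    {x : MvPolynomial (Fin f × Fin 2) K} (hx : x ∈ NMain p f K r0) :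
    actMain p f F K g x ∈ NMain p f K r0 := by
  obtain ⟨z, hz⟩ : ∃ z : Fin 2 → K, ∀ l : Fin f, algebraMap F K (g 0 0) ^ p ^ (l : ℕ) * z 0 +
      algebraMap F K (g 1 0) ^ p ^ (l : ℕ) * z 1 ≠ 0 := by
    rcases hg with h | h
    · exact ⟨![1, 0], fun l => by simpa using fun h' => absurd h' h⟩
    · exact ⟨![0, 1], fun l => by simpa using fun h' => absurd h' h⟩
  have hmem := inclMain_mul_topVec_mem_NBig p f hx
  have hact : actBig p f F K g (inclMain f K x * topVec p f K) ∈ NBig p f K r0 := by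
    refine mem_NBig_of_cuspRestrict_eq_zero p f hr0 hr0' hF hK hα (isMDegBig_actBig
      (isMDegBig_of_mem_NBig p f (Fact.out : p.Prime).one_le (by omega) hmem) g) ?_
    funext y
    simp only [cuspRestrict, LinearMap.pi_apply]
    rw [cuspFunctional_actBig p f r0 fun a => by rw [← map_pow, ← hF, FiniteField.pow_card]]
    exact cuspFunctional_eq_zero_of_mem_NBig p f hr0 hr0' hK _ hmem
  have := evSnd_mem_NMain p f z hact
  rw [evSnd_actBig] at this
  exact (Submodule.smul_mem_iff _
    (Finset.prod_ne_zero_iff.2 fun l _ => pow_ne_zero _ (hz l))).1 this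

/-- Every invertible matrix is the product of an element of the torus and a matrix
`[[1, b], [0, d]]`. -/
theorem exists_torus_mul_eq {F K : Type*} [Field F] [Field K] [Algebra F K] {α : K} {β : F}
    (hα : α ^ 2 = algebraMap F K β) (hα' : α ∉ Set.range (algebraMap F K))
    (x : Matrix.GeneralLinearGroup (Fin 2) F) :
    ∃ (t : Matrix.GeneralLinearGroup (Fin 2) F) (u v b : F) (d : Fˣ),
      t.val = !![u, v * β; v, u] ∧
        x.val = t.val * !![1, b; 0, d] := by
  obtain ⟨u, hu⟩ : ∃ u, u = x.val 0 0 := ⟨_, rfl⟩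
  obtain ⟨v, hv⟩ : ∃ v, v = x.val 1 0 := ⟨_, rfl⟩
  have hdet : x.val.det ≠ 0 := Matrix.GeneralLinearGroup.det_ne_zero x
  rw [Matrix.det_fin_two, ← hu, ← hv] at hdet
  have hN : ∀ w : F, w ^ 2 = v ^ 2 → algebraMap F K u + algebraMap F K w * α ≠ 0 := by
    intro w hw h
    by_cases hw0 : w = 0
    · subst hw0
      have hv0 : v = 0 := by simpa using hw.symm
      have hu0 : u = 0 := by simpa using h
      simp [hu0, hv0] at hdet
    · refine hα' ⟨-u / w, ?_⟩
      have : algebraMap F K w ≠ 0 := by simpa using hw0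
      rw [map_div₀, map_neg, div_eq_iff this]
      linear_combination -h
  have hNF : u ^ 2 - v ^ 2 * β ≠ 0 := by
    intro h
    refine mul_ne_zero (hN v rfl) (hN (-v) (neg_sq v)) ?_
    rw [map_neg]
    have := congrArg (algebraMap F K) h
    simp only [map_sub, map_mul, map_pow, map_zero, ← hα] at this
    linear_combination this
  have hd : (u * x.val 1 1 - v * x.val 0 1) / (u ^ 2 - v ^ 2 * β) ≠ 0 :=
    div_ne_zero (fun h => hdet (by linear_combination h)) hNF
  refine ⟨Matrix.GeneralLinearGroup.mkOfDetNeZero !![u, v * β; v, u] ?_, u, v,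
    (u * x.val 0 1 - v * β * x.val 1 1) / (u ^ 2 - v ^ 2 * β), Units.mk0 _ hd, rfl, ?_⟩
  · rw [Matrix.det_fin_two_of]
    exact fun h => hNF (by linear_combination h)
  · change x.val = !![u, v * β; v, u] * _
    ext i j
    fin_cases i <;> fin_cases j
    · simp [Matrix.mul_apply, Fin.sum_univ_two, hu]
    · simp [Matrix.mul_apply, Fin.sum_univ_two]
      field_simp
      ring
    · simp [Matrix.mul_apply, Fin.sum_univ_two, hv]
    · simp [Matrix.mul_apply, Fin.sum_univ_two]
      field_simp
      ring

/-- for `2 ≤ r_0 ≤ p−1`, the span `⟨D_0,…,D_{f−1}⟩` is a `G`-subrepresentation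
of the multidegree-`(r_0+p−1, p−1,…,p−1)` component `W`, and there is a `G`-equivariant
`𝔽_{q²}`-linear isomorphism
`((W/⟨D_0,…,D_{f−1}⟩) ⊗ ⊗_j V_{p−1}^{Fr^j}) ⊗ 𝔽_{q²} ≅ ind_{T(𝔽_q)}^G ω_{2f}^{r_0}`,
expressed here by a linear map `ψ` inducing it. -/
theorem twisted_cuspidal_iso (p f : ℕ) [Fact p.Prime] [NeZero f] (hodd : Odd (p ^ f))
    (r0 : ℕ) (hr0 : 2 ≤ r0) (hr0' : r0 ≤ p - 1)
    (F K : Type*) [Field F] [Fintype F] [Field K] [Fintype K] [Algebra F K]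
    (hF : Fintype.card F = p ^ f) (hK : Fintype.card K = p ^ (2 * f))
    (α : K) (β : F) (hα : α ^ 2 = algebraMap F K β)
    (hα' : α ∉ Set.range (algebraMap F K)) :
    -- `⟨D_0,…,D_{f−1}⟩` is a `G`-subrepresentation of `W`
    (∀ g : Matrix.GeneralLinearGroup (Fin 2) F,
        ∀ x ∈ NMain p f K r0, actMain p f F K g.val x ∈ NMain p f K r0) ∧
    -- the isomorphism
    (∃ ψ : MvPolynomial (Fin 2 × Fin f × Fin 2) K →ₗ[K]
        (Matrix.GeneralLinearGroup (Fin 2) F → K),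
      -- `ψ_R` lies in `ind_{T(𝔽_q)}^G ω_{2f}^{r_0}`
      (∀ R : MvPolynomial (Fin 2 × Fin f × Fin 2) K,
          IsMDegBig f (fun sl => if sl.1 = 0 ∧ sl.2 = 0 then r0 + p - 1 else p - 1) R →
          ∀ (t g : Matrix.GeneralLinearGroup (Fin 2) F) (u v : F),
            t.val = !![u, v * β; v, u] →
            ψ R (t * g) =
              (algebraMap F K u + algebraMap F K v * α) ^ r0 * ψ R g) ∧
      -- `G`-equivariance
      (∀ (g : Matrix.GeneralLinearGroup (Fin 2) F)
          (R : MvPolynomial (Fin 2 × Fin f × Fin 2) K),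
          IsMDegBig f (fun sl => if sl.1 = 0 ∧ sl.2 = 0 then r0 + p - 1 else p - 1) R →
          ψ (actBig p f F K g.val R) = fun x => ψ R (x * g)) ∧
      -- the kernel is `⟨D_0,…,D_{f−1}⟩ ⊗ (⊗_j V_{p−1}^{Fr^j})`
      (∀ R : MvPolynomial (Fin 2 × Fin f × Fin 2) K,
          IsMDegBig f (fun sl => if sl.1 = 0 ∧ sl.2 = 0 then r0 + p - 1 else p - 1) R →
          (ψ R = 0 ↔ R ∈ NBig p f K r0)) ∧
      -- surjectivity onto `ind_{T(𝔽_q)}^G ω_{2f}^{r_0}`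
      (∀ h : Matrix.GeneralLinearGroup (Fin 2) F → K,
          (∀ (t g : Matrix.GeneralLinearGroup (Fin 2) F) (u v : F),
              t.val = !![u, v * β; v, u] →
              h (t * g) = (algebraMap F K u + algebraMap F K v * α) ^ r0 * h g) →
          ∃ R, IsMDegBig f
              (fun sl => if sl.1 = 0 ∧ sl.2 = 0 then r0 + p - 1 else p - 1) R ∧
            ψ R = h)) := by
  have : CharP K p := charP_of_card_eq_prime_pow hK
  have hFp : ∀ a : F, algebraMap F K a ^ p ^ f = algebraMap F K a := fun a => by
    rw [← map_pow, ← hF, FiniteField.pow_card]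
  have hKp : ∀ a : K, (a ^ p ^ f) ^ p ^ f = a := fun a => by
    rw [← pow_mul, ← pow_add, ← two_mul, ← hK, FiniteField.pow_card]
  have hαq : α ^ p ^ f ≠ α := hF ▸ FiniteField.pow_card_ne_self hα'
  have hdet : ∀ (b : F) (d : Fˣ), (!![1, b; 0, (d : F)]).det ≠ 0 := by simp
  let ψ : MvPolynomial (Fin 2 × Fin f × Fin 2) K →ₗ[K]
      (Matrix.GeneralLinearGroup (Fin 2) F → K) :=
    LinearMap.pi fun g => cuspFunctional p f r0 (rowVec α g.val)
  have hT : ∀ R, IsMDegBig f (bigDeg p f r0) R →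
      ∀ (t g : Matrix.GeneralLinearGroup (Fin 2) F) (u v : F), t.val = !![u, v * β; v, u] →
        ψ R (t * g) = (algebraMap F K u + algebraMap F K v * α) ^ r0 * ψ R g := by
    intro R hR t g u v ht
    have hc : algebraMap F K u + algebraMap F K v * α ≠ 0 := by
      intro h
      have hdet := Matrix.GeneralLinearGroup.det_ne_zero t
      rw [ht, Matrix.det_fin_two_of, ← (algebraMap F K).injective.ne_iff, map_zero] at hdet
      refine hdet ?_
      simp only [map_sub, map_mul, ← hα]
      linear_combination (algebraMap F K u - algebraMap F K v * α) * h
    simp only [ψ, LinearMap.pi_apply, Units.val_mul]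
    rw [ht, rowVec_torus_mul hα, cuspFunctional_smul p f hr0 hKp _ hc hR]
  refine ⟨fun g x hx => actMain_mem_NMain p f hr0 hr0' hF hKp hαq ?_ hx, ψ, hT, fun g R _ => ?_,
    fun R hR => ⟨fun h => ?_, fun h => ?_⟩, fun h hh => ?_⟩
  · by_contra! h
    refine Matrix.GeneralLinearGroup.det_ne_zero g ?_
    rw [Matrix.det_fin_two, h.1, h.2, zero_mul, mul_zero, sub_zero]
  · funext x
    simp only [ψ, LinearMap.pi_apply, Units.val_mul]
    rw [cuspFunctional_actBig p f r0 hFp, rowVec_mul]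
  · refine mem_NBig_of_cuspRestrict_eq_zero p f hr0 hr0' hF hKp hαq hR ?_
    funext x
    exact congrFun h (Matrix.GeneralLinearGroup.mkOfDetNeZero _ (hdet x.1 x.2))
  · funext x
    exact cuspFunctional_eq_zero_of_mem_NBig p f hr0 hr0' hKp _ h
  · obtain ⟨R, hR, hRh⟩ := cuspRestrict_surjective p f hr0 hr0' hF hαq fun x : F × Fˣ =>
      h (Matrix.GeneralLinearGroup.mkOfDetNeZero _ (hdet x.1 x.2))
    refine ⟨R, hR, funext fun x => ?_⟩
    obtain ⟨t, u, v, b, d, ht, hx⟩ := exists_torus_mul_eq hα hα' x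
    obtain rfl : x = t * Matrix.GeneralLinearGroup.mkOfDetNeZero _ (hdet b d) := Units.ext hx
    rw [hT R hR t _ u v ht, hh t _ u v ht]
    exact congrArg _ (congrFun hRh (b, d))
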